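/- Suppose G ∈ F, κ(G) = 2, S = {a,b} is any basic 2-cut of G, and C is the heavy component of G − S. If H_a and H_b are any Kuratowski subgraphs of G avoiding a and b respectively, then every edge of G with both endpoints in C belongs to E(H_a) ∪ E(H_b). -/

import Mathlib

open SimpleGraph

/-- The complete graph on five vertices. -/
def K5 : SimpleGraph (Fin 5) := ⊤

/-- The complete bipartite graph `K_{3,3}`. -/
def K33 : SimpleGraph (Fin 6) :=
  SimpleGraph.fromRel (fun i j => i.val < 3 ∧ 3 ≤ j.val)

/-- `K_{3,3}` plus one extra edge joining two vertices in the same part. -/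
def K33e : SimpleGraph (Fin 6) :=
  SimpleGraph.fromRel (fun i j => (i.val < 3 ∧ 3 ≤ j.val) ∨ (i.val = 0 ∧ j.val = 1))

/-- `H` is a minor of `G`, witnessed by a family of nonempty, connected,
pairwise disjoint branch sets together with edges between the branch sets of
adjacent vertices of `H`. -/
def SimpleGraph.IsMinorOf {W V : Type} (H : SimpleGraph W) (G : SimpleGraph V) : Prop :=
  ∃ f : W → Set V,
    (∀ w, (G.induce (f w)).Connected) ∧
    (Pairwise fun w w' => Disjoint (f w) (f w')) ∧
    (∀ ⦃w w'⦄, H.Adj w w' → ∃ u ∈ f w, ∃ v ∈ f w', G.Adj u v)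

/-- Planarity, via the Kuratowski–Wagner characterization: a (finite simple) graph is
planar iff it has no `K₅` minor and no `K_{3,3}` minor. -/
def IsPlanar {V : Type} (G : SimpleGraph V) : Prop :=
  ¬ K5.IsMinorOf G ∧ ¬ K33.IsMinorOf G

/-- A graph is apex if it is planar or some vertex deletion makes it planar. -/
def IsApex {V : Type} (G : SimpleGraph V) : Prop :=
  IsPlanar G ∨ ∃ v : V, IsPlanar (G.induce {u | u ≠ v})

/-- `G` is an obstruction for the apex family: it is not apex, but every minor of it
that is not isomorphic to it is apex. -/
def IsApexObstruction {V : Type} (G : SimpleGraph V) : Prop :=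
  ¬ IsApex G ∧
    ∀ (W : Type) (H : SimpleGraph W), H.IsMinorOf G → IsEmpty (H ≃g G) → IsApex H

/-- Subdivide the edge `uv` of `G`: the new vertex is `none`. -/
def subdivideEdge {V : Type} (G : SimpleGraph V) (u v : V) : SimpleGraph (Option V) :=
  SimpleGraph.fromRel (fun x y =>
    (∃ a b, x = some a ∧ y = some b ∧ G.Adj a b ∧ s(a, b) ≠ s(u, v)) ∨
    (x = none ∧ (y = some u ∨ y = some v)))

/-- `IsSubdivision G H` : `H` is (isomorphic to) a graph obtained from `G` by repeatedly
subdividing edges. -/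
inductive IsSubdivision : {V : Type} → SimpleGraph V → {W : Type} → SimpleGraph W → Prop
  | of_iso {V W : Type} {G : SimpleGraph V} {H : SimpleGraph W} :
      (G ≃g H) → IsSubdivision G H
  | step {V W U : Type} {G : SimpleGraph V} {H : SimpleGraph W} {u v : W}
      {H' : SimpleGraph U} :
      H.Adj u v → IsSubdivision G H → (subdivideEdge H u v ≃g H') → IsSubdivision G H'

/-- A Kuratowski subgraph of `G` is a subgraph that is a subdivision of `K₅` or `K_{3,3}`. -/
def IsKuratowski {V : Type} {G : SimpleGraph V} (H : G.Subgraph) : Prop :=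
  IsSubdivision K5 H.coe ∨ IsSubdivision K33 H.coe

/-- A Kuratowski witness for `v` is a Kuratowski subgraph of `G` avoiding `v`. -/
def IsKuratowskiWitness {V : Type} (G : SimpleGraph V) (v : V) (H : G.Subgraph) : Prop :=
  IsKuratowski H ∧ v ∉ H.verts

/-- A branch vertex of a (Kuratowski) subgraph: a vertex of degree at least 3 in it. -/
def IsBranchVertex {V : Type} {G : SimpleGraph V} (H : G.Subgraph) (x : V) : Prop :=
  x ∈ H.verts ∧ 3 ≤ (H.neighborSet x).ncard

/-- The vertex connectivity of a finite graph: the largest `k` such that deleting any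
fewer than `k` vertices leaves a connected graph. -/
noncomputable def vConn {V : Type} [Fintype V] (G : SimpleGraph V) : ℕ :=
  sSup {k : ℕ | ∀ s : Finset V, s.card < k → (G.induce ((↑s : Set V)ᶜ)).Connected}

/-- A 2-cut: a set of two vertices whose deletion disconnects the graph. -/
def IsTwoCut {V : Type} (G : SimpleGraph V) (S : Set V) : Prop :=
  S.ncard = 2 ∧ ¬ (G.induce Sᶜ).Preconnected

/-- `C` is (the vertex set of) a connected component of `G − S`. -/
def IsCompOf {V : Type} (G : SimpleGraph V) (S : Set V) (C : Set V) : Prop :=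
  C.Nonempty ∧ Disjoint C S ∧ (G.induce C).Connected ∧
    ∀ u ∈ C, ∀ v, v ∉ S → G.Adj u v → v ∈ C

/-- The augmented component `C⁺`: the subgraph induced by `C ∪ S` together with all
edges joining vertices of `S`. -/
def augment {V : Type} (G : SimpleGraph V) (S C : Set V) : SimpleGraph ↥(C ∪ S) :=
  SimpleGraph.fromRel (fun u v => G.Adj (u : V) (v : V) ∨ ((u : V) ∈ S ∧ (v : V) ∈ S))

/-- `C` is a heavy component for the 2-cut `{a,b}`: a component of `G − {a,b}` whose
augmentation contains Kuratowski witnesses for both `a` and `b`. -/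
def IsHeavyComp {V : Type} (G : SimpleGraph V) (a b : V) (C : Set V) : Prop :=
  IsCompOf G {a, b} C ∧
    (∃ Ha : G.Subgraph, IsKuratowskiWitness G a Ha ∧ Ha.verts ⊆ C ∪ {a, b}) ∧
    (∃ Hb : G.Subgraph, IsKuratowskiWitness G b Hb ∧ Hb.verts ⊆ C ∪ {a, b})

/-- `{a,b}` is a basic 2-cut with heavy component `C`: a 2-cut whose heavy-component
weight is minimum among all 2-cuts. -/
def IsBasic2Cut {V : Type} (G : SimpleGraph V) (a b : V) (C : Set V) : Prop :=
  IsTwoCut G {a, b} ∧ IsHeavyComp G a b C ∧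
    ∀ c d : V, ∀ D : Set V, IsTwoCut G {c, d} → IsHeavyComp G c d D → C.ncard ≤ D.ncard

/-- The subgraph of `G` induced by `A`, kept on the same vertex set (vertices outside `A`
become isolated). -/
def restrictTo {V : Type} (G : SimpleGraph V) (A : Set V) : SimpleGraph V :=
  SimpleGraph.fromRel (fun u v => G.Adj u v ∧ u ∈ A ∧ v ∈ A)

/-- Contract the edge `uv` of `G`, keeping the label `u` for the merged vertex
(`v` becomes isolated). -/
def contractEdge {V : Type} (G : SimpleGraph V) (u v : V) : SimpleGraph V :=
  SimpleGraph.fromRel (fun x y =>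
    x ≠ v ∧ y ≠ v ∧ (G.Adj x y ∨ (x = u ∧ G.Adj v y) ∨ (y = u ∧ G.Adj x v)))

/-- `T` separates `a` from `b` in `G`: `a, b ∉ T` and every walk from `a` to `b`
meets `T`. -/
def Separates {V : Type} (G : SimpleGraph V) (T : Set V) (a b : V) : Prop :=
  a ∉ T ∧ b ∉ T ∧ ∀ p : G.Walk a b, ∃ t ∈ T, t ∈ p.support

/-- Disjoint union of two graphs. -/
def disjUnion {V W : Type} (G : SimpleGraph V) (H : SimpleGraph W) : SimpleGraph (V ⊕ W) :=
  SimpleGraph.fromRel (fun x y =>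
    (∃ a b, x = Sum.inl a ∧ y = Sum.inl b ∧ G.Adj a b) ∨
    (∃ a b, x = Sum.inr a ∧ y = Sum.inr b ∧ H.Adj a b))

/-- The graph on `Fin n` with the given list of edges. -/
def graphOfList (n : ℕ) (l : List (ℕ × ℕ)) : SimpleGraph (Fin n) :=
  SimpleGraph.fromRel (fun i j => ((i : ℕ), (j : ℕ)) ∈ l)

/-- A graph is 2-connected: at least three vertices and no cut vertex. -/
def IsTwoConnectedGraph {U : Type} (H : SimpleGraph U) : Prop :=
  3 ≤ Nat.card U ∧ ∀ u : U, (H.induce {x | x ≠ u}).Connected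

/-! ### Connected vertex sets -/

/-- `B` induces a connected subgraph of `H`, phrased through adjacency-closed sets. -/
def ConnectedOn {V : Type} (H : SimpleGraph V) (B : Set V) : Prop :=
  B.Nonempty ∧ ∀ P : Set V, (∃ x ∈ B, x ∈ P) →
    (∀ x ∈ B, x ∈ P → ∀ y ∈ B, H.Adj x y → y ∈ P) → B ⊆ P

theorem connectedOn_iff {V : Type} {H : SimpleGraph V} {B : Set V} :
    ConnectedOn H B ↔ (H.induce B).Connected := by
  constructor
  · rintro ⟨⟨r, hr⟩, h⟩
    rw [connected_iff_exists_forall_reachable]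
    refine ⟨⟨r, hr⟩, fun ⟨w, hw⟩ => ?_⟩
    have := h {x | ∃ hx : x ∈ B, (H.induce B).Reachable ⟨r, hr⟩ ⟨x, hx⟩}
      ⟨r, hr, hr, Reachable.refl _⟩ (by
        rintro x _ ⟨hx, hrx⟩ y hy hxy
        refine ⟨hy, hrx.trans (Adj.reachable ?_)⟩
        simpa using hxy) hw
    exact this.2
  · intro h
    obtain ⟨r⟩ := h.nonempty
    refine ⟨⟨r, r.2⟩, fun P ⟨x, hxB, hxP⟩ hcl y hy => ?_⟩
    have hr := h.preconnected ⟨x, hxB⟩ ⟨y, hy⟩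
    rw [reachable_iff_reflTransGen] at hr
    have key : ∀ z : B, Relation.ReflTransGen (H.induce B).Adj ⟨x, hxB⟩ z → (z : V) ∈ P := by
      intro z hz
      induction hz with
      | refl => exact hxP
      | tail _ hbc ih => exact hcl _ (Subtype.prop _) ih _ (Subtype.prop _) (by simpa using hbc)
    exact key _ hr

theorem ConnectedOn.mono {V : Type} {H H' : SimpleGraph V} {B : Set V} (h : ConnectedOn H B)
    (hle : ∀ x ∈ B, ∀ y ∈ B, H.Adj x y → H'.Adj x y) : ConnectedOn H' B :=
  ⟨h.1, fun P hP hcl => h.2 P hP fun x hx hxP y hy hxy => hcl x hx hxP y hy (hle x hx y hy hxy)⟩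

theorem connectedOn_singleton {V : Type} (H : SimpleGraph V) (x : V) : ConnectedOn H {x} :=
  ⟨⟨x, rfl⟩, by rintro P ⟨y, rfl, hy⟩ _ z rfl; exact hy⟩

theorem ConnectedOn.image {V V' : Type} {H : SimpleGraph V} {H' : SimpleGraph V'} {B : Set V}
    (φ : V → V') (h : ConnectedOn H B)
    (hφ : ∀ x ∈ B, ∀ y ∈ B, H.Adj x y → φ x = φ y ∨ H'.Adj (φ x) (φ y)) :
    ConnectedOn H' (φ '' B) := by
  refine ⟨h.1.image φ, ?_⟩
  rintro P ⟨_, ⟨x, hx, rfl⟩, hxP⟩ hcl _ ⟨y, hy, rfl⟩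
  refine h.2 (φ ⁻¹' P) ⟨x, hx, hxP⟩ (fun s hs hsP t ht hst => ?_) hy
  rcases hφ s hs t ht hst with heq | hadj
  · simpa [← heq] using hsP
  · exact hcl _ ⟨s, hs, rfl⟩ hsP _ ⟨t, ht, rfl⟩ hadj

theorem ConnectedOn.union_of_adj {V : Type} {H : SimpleGraph V} {B D : Set V}
    (hB : ConnectedOn H B) (hD : ConnectedOn H D)
    (hBD : ∃ x ∈ B, ∃ y ∈ D, x = y ∨ H.Adj x y) : ConnectedOn H (B ∪ D) := by
  obtain ⟨x, hx, y, hy, hxy⟩ := hBD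
  refine ⟨⟨x, Or.inl hx⟩, ?_⟩
  rintro P ⟨z, hz, hzP⟩ hcl
  have h1 : (∃ s ∈ B, s ∈ P) → B ⊆ P := fun hs => hB.2 P hs fun s hs hsP t ht hst =>
    hcl s (Or.inl hs) hsP t (Or.inl ht) hst
  have h2 : (∃ s ∈ D, s ∈ P) → D ⊆ P := fun hs => hD.2 P hs fun s hs hsP t ht hst =>
    hcl s (Or.inr hs) hsP t (Or.inr ht) hst
  have hiff : x ∈ P ↔ y ∈ P := by
    rcases hxy with rfl | hadj
    · rfl
    · exact ⟨fun h => hcl x (Or.inl hx) h y (Or.inr hy) hadj,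
        fun h => hcl y (Or.inr hy) h x (Or.inl hx) hadj.symm⟩
  rcases hz with hz | hz
  · have hBP := h1 ⟨z, hz, hzP⟩
    exact Set.union_subset hBP (h2 ⟨y, hy, hiff.1 (hBP hx)⟩)
  · have hDP := h2 ⟨z, hz, hzP⟩
    exact Set.union_subset (h1 ⟨x, hx, hiff.2 (hDP hy)⟩) hDP

/-- The component of `a` in the subgraph induced by `A`. -/
theorem exists_component {V : Type} (H : SimpleGraph V) {A : Set V} {a : V} (ha : a ∈ A) :
    ∃ T ⊆ A, a ∈ T ∧ ConnectedOn H T ∧ ∀ x ∈ T, ∀ y ∈ A, H.Adj x y → y ∈ T := by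
  refine ⟨⋃₀ {T | T ⊆ A ∧ a ∈ T ∧ ConnectedOn H T}, Set.sUnion_subset fun T hT => hT.1,
    ⟨{a}, ⟨by simpa using ha, rfl, connectedOn_singleton H a⟩, rfl⟩, ⟨⟨a, {a},
    ⟨by simpa using ha, rfl, connectedOn_singleton H a⟩, rfl⟩, ?_⟩, ?_⟩
  · rintro P ⟨x, ⟨T, hT, hxT⟩, hxP⟩ hcl
    have hsub : ∀ T', T' ⊆ A ∧ a ∈ T' ∧ ConnectedOn H T' → (∃ x ∈ T', x ∈ P) → T' ⊆ P :=
      fun T' hT' hx => hT'.2.2.2 P hx fun s hs hsP t ht hst =>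
        hcl s ⟨T', hT', hs⟩ hsP t ⟨T', hT', ht⟩ hst
    have haP : a ∈ P := hsub T hT ⟨x, hxT, hxP⟩ hT.2.1
    rintro y ⟨T', hT', hyT'⟩
    exact hsub T' hT' ⟨a, hT'.2.1, haP⟩ hyT'
  · rintro x ⟨T, hT, hxT⟩ y hy hxy
    refine ⟨T ∪ {y}, ⟨Set.union_subset hT.1 (by simpa using hy), Or.inl hT.2.1,
      hT.2.2.union_of_adj (connectedOn_singleton H y) ⟨x, hxT, y, rfl, Or.inr hxy⟩⟩, Or.inr rfl⟩

theorem ConnectedOn.exists_adj_of_mem {V : Type} {H : SimpleGraph V} {Q : Set V} {a b : V}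
    (hQ : ConnectedOn H Q) (ha : a ∈ Q) (hb : b ∈ Q) (hab : a ≠ b) :
    ∃ T ⊆ Q \ {b}, a ∈ T ∧ ConnectedOn H T ∧ ∃ y ∈ T, H.Adj y b := by
  obtain ⟨T, hTQ, haT, hT, hcl⟩ := exists_component H (A := Q \ {b}) (a := a) ⟨ha, hab⟩
  refine ⟨T, hTQ, haT, hT, ?_⟩
  by_contra! hno
  have := hQ.2 T ⟨a, ha, haT⟩ (fun x _ hxT y hy hxy => hcl x hxT y
    ⟨hy, fun h => hno x hxT (by rw [← Set.mem_singleton_iff.1 h]; exact hxy)⟩ hxy) hb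
  exact (hTQ this).2 rfl

theorem ConnectedOn.exists_adj_boundary {V : Type} {H : SimpleGraph V} {B P : Set V}
    (hB : ConnectedOn H B) (hin : ∃ x ∈ B, x ∈ P) (hout : ∃ x ∈ B, x ∉ P) :
    ∃ x ∈ B, x ∈ P ∧ ∃ y ∈ B, y ∉ P ∧ H.Adj x y := by
  by_contra! hno
  obtain ⟨z, hz, hzP⟩ := hout
  exact hzP (hB.2 P hin (fun x hx hxP y hy hxy => by
    by_contra hyP
    exact hno x hx hxP y hy hyP hxy) hz)

/-- A finite connected set with a second vertex has a non-cut vertex other than `r`. -/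
theorem ConnectedOn.exists_connectedOn_diff {V : Type} [Finite V] {H : SimpleGraph V} {B : Set V}
    (hB : ConnectedOn H B) {r s : V} (hr : r ∈ B) (hs : s ∈ B) (hrs : s ≠ r) :
    ∃ x ∈ B, x ≠ r ∧ ConnectedOn H (B \ {x}) := by
  obtain ⟨T, ⟨hTB, hrT, hT, hne⟩, hmax⟩ :=
    (Set.toFinite {T : Set V | T ⊆ B ∧ r ∈ T ∧ ConnectedOn H T ∧ T ≠ B}).exists_maximal
      ⟨{r}, by simpa using hr, rfl, connectedOn_singleton H r, fun h => hrs (by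
        rw [← h] at hs; exact hs)⟩
  obtain ⟨x, hx, hxT, y, hy, hyT, hxy⟩ := hB.exists_adj_boundary ⟨r, hr, hrT⟩ (by
    by_contra! hno; exact hne (hTB.antisymm hno))
  have hT' : ConnectedOn H (T ∪ {y}) :=
    hT.union_of_adj (connectedOn_singleton H y) ⟨x, hxT, y, rfl, Or.inr hxy⟩
  have hEq : T ∪ {y} = B := by
    by_contra hneq
    exact hyT (hmax ⟨Set.union_subset hTB (by simpa using hy), Or.inl hrT, hT', hneq⟩
      Set.subset_union_left (Or.inr rfl))
  refine ⟨y, hy, fun h => hyT (h ▸ hrT), ?_⟩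
  have : B \ {y} = T := by
    rw [← hEq]
    ext z
    simp only [Set.mem_sdiff, Set.mem_union, Set.mem_singleton_iff]
    constructor
    · rintro ⟨h | h, h'⟩
      · exact h
      · exact absurd h h'
    · exact fun h => ⟨Or.inl h, fun hz => hyT (hz ▸ h)⟩
  rwa [this]

/-- Restricting a connected set to one side of a separation whose separator is a clique. -/
theorem ConnectedOn.inter_of_clique {V : Type} {H : SimpleGraph V} {B A₁ A₂ : Set V}
    (hB : ConnectedOn H B) (hcov : B ⊆ A₁ ∪ A₂)
    (hsep : ∀ x ∈ A₁, ∀ y ∈ A₂, H.Adj x y → x ∈ A₂ ∨ y ∈ A₁)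
    (hclique : ∀ x ∈ A₁ ∩ A₂, ∀ y ∈ A₁ ∩ A₂, x ≠ y → H.Adj x y)
    (hne : (B ∩ A₁).Nonempty) : ConnectedOn H (B ∩ A₁) := by
  refine ⟨hne, ?_⟩
  rintro P ⟨r, hr, hrP⟩ hcl
  by_cases hS : ∃ s ∈ B ∩ (A₁ ∩ A₂), s ∈ P
  · obtain ⟨s, ⟨hsB, hs⟩, hsP⟩ := hS
    have hall : ∀ t ∈ B ∩ (A₁ ∩ A₂), t ∈ P := by
      rintro t ⟨htB, ht⟩
      by_cases hst : s = t
      · exact hst ▸ hsP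
      · exact hcl s ⟨hsB, hs.1⟩ hsP t ⟨htB, ht.1⟩ (hclique s hs t ht hst)
    have := hB.2 ((P ∩ A₁) ∪ A₂) ⟨r, hr.1, Or.inl ⟨hrP, hr.2⟩⟩ (by
      intro x hx hxP y hy hxy
      rcases hcov hy with hy1 | hy2
      · refine Or.inl ⟨?_, hy1⟩
        rcases hxP with hxP | hx2
        · exact hcl x ⟨hx, hxP.2⟩ hxP.1 y ⟨hy, hy1⟩ hxy
        · rcases hsep y hy1 x hx2 hxy.symm with h | h
          · exact hall y ⟨hy, hy1, h⟩
          · exact hcl x ⟨hx, h⟩ (hall x ⟨hx, h, hx2⟩) y ⟨hy, hy1⟩ hxy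
      · exact Or.inr hy2)
    rintro z ⟨hzB, hz1⟩
    rcases this hzB with h | h
    · exact h.1
    · exact hall z ⟨hzB, hz1, h⟩
  · push Not at hS
    have := hB.2 (P ∩ A₁) ⟨r, hr.1, hrP, hr.2⟩ (by
      rintro x hx ⟨hxP, hx1⟩ y hy hxy
      have hy1 : y ∈ A₁ := by
        rcases hcov hy with h | h
        · exact h
        · rcases hsep x hx1 y h hxy with h' | h'
          · exact absurd hxP (hS x ⟨hx, hx1, h'⟩)
          · exact h'
      exact ⟨hcl x ⟨hx, hx1⟩ hxP y ⟨hy, hy1⟩ hxy, hy1⟩)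
    exact fun z hz => (this hz.1).1

/-! ### Minor models inside a vertex set -/

/-- The sets `f w` form a minor model of `K` in `H` inside the vertex set `A`. -/
structure IsModelOn {V W : Type} (K : SimpleGraph W) (H : SimpleGraph V) (A : Set V)
    (f : W → Set V) : Prop where
  subset : ∀ w, f w ⊆ A
  conn : ∀ w, ConnectedOn H (f w)
  disj : ∀ w w' x, x ∈ f w → x ∈ f w' → w = w'
  adj : ∀ w w', K.Adj w w' → ∃ u ∈ f w, ∃ v ∈ f w', H.Adj u v

/-- `K` has a minor model in `H` inside the vertex set `A`. -/
def HasModelOn {V W : Type} (K : SimpleGraph W) (H : SimpleGraph V) (A : Set V) : Prop :=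
  ∃ f, IsModelOn K H A f

/-- The subgraph of `H` induced by `A` is not planar. -/
def NonplanarOn {V : Type} (H : SimpleGraph V) (A : Set V) : Prop :=
  HasModelOn K5 H A ∨ HasModelOn K33 H A

theorem IsModelOn.isMinorOf {V W : Type} {K : SimpleGraph W} {H : SimpleGraph V}
    {f : W → Set V} (hf : IsModelOn K H Set.univ f) : K.IsMinorOf H :=
  ⟨f, fun w => connectedOn_iff.1 (hf.conn w),
    fun w w' hne => Set.disjoint_left.2 fun x hx hx' => hne (hf.disj w w' x hx hx'),
    fun w w' h => hf.adj w w' h⟩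

theorem hasModelOn_univ {V W : Type} {K : SimpleGraph W} {H : SimpleGraph V} :
    HasModelOn K H Set.univ ↔ K.IsMinorOf H := by
  refine ⟨fun ⟨f, hf⟩ => hf.isMinorOf, ?_⟩
  rintro ⟨f, hconn, hdisj, hadj⟩
  refine ⟨f, fun _ => Set.subset_univ _, fun w => connectedOn_iff.2 (hconn w), ?_,
    fun w w' h => hadj h⟩
  intro w w' x hx hx'
  by_contra hne
  exact Set.disjoint_left.1 (hdisj hne) hx hx'

theorem IsModelOn.map {V V' W : Type} {K : SimpleGraph W} {H : SimpleGraph V}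
    {H' : SimpleGraph V'} {A : Set V} {f : W → Set V} (hf : IsModelOn K H A f) (φ : V → V')
    (hinj : Set.InjOn φ A) (hφ : ∀ x ∈ A, ∀ y ∈ A, H.Adj x y → H'.Adj (φ x) (φ y)) :
    IsModelOn K H' (φ '' A) fun w => φ '' f w where
  subset w := Set.image_mono (hf.subset w)
  conn w := (hf.conn w).image φ fun x hx y hy h =>
    Or.inr (hφ x (hf.subset w hx) y (hf.subset w hy) h)
  disj := by
    rintro w w' _ ⟨x, hx, rfl⟩ ⟨y, hy, hxy⟩
    have := hinj (hf.subset _ hy) (hf.subset _ hx) hxy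
    exact hf.disj w w' x hx (this ▸ hy)
  adj w w' h := by
    obtain ⟨u, hu, v, hv, huv⟩ := hf.adj w w' h
    exact ⟨φ u, ⟨u, hu, rfl⟩, φ v, ⟨v, hv, rfl⟩, hφ u (hf.subset _ hu) v (hf.subset _ hv) huv⟩

theorem IsModelOn.mono_set {V W : Type} {K : SimpleGraph W} {H : SimpleGraph V}
    {A A' : Set V} {f : W → Set V} (hf : IsModelOn K H A f) (hA : A ⊆ A') : IsModelOn K H A' f :=
  ⟨fun w => (hf.subset w).trans hA, hf.conn, hf.disj, hf.adj⟩

theorem NonplanarOn.map {V V' : Type} {H : SimpleGraph V} {H' : SimpleGraph V'} {A : Set V}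
    {A' : Set V'} (h : NonplanarOn H A) (φ : V → V') (hinj : Set.InjOn φ A)
    (hφ : ∀ x ∈ A, ∀ y ∈ A, H.Adj x y → H'.Adj (φ x) (φ y)) (hA : φ '' A ⊆ A') :
    NonplanarOn H' A' :=
  h.imp (fun ⟨_, hf⟩ => ⟨_, (hf.map φ hinj hφ).mono_set hA⟩)
    (fun ⟨_, hf⟩ => ⟨_, (hf.map φ hinj hφ).mono_set hA⟩)

theorem NonplanarOn.mono' {V : Type} {H H' : SimpleGraph V} {A A' : Set V}
    (h : NonplanarOn H A) (hH : ∀ x ∈ A, ∀ y ∈ A, H.Adj x y → H'.Adj x y) (hA : A ⊆ A') :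
    NonplanarOn H' A' :=
  h.map id (Set.injOn_id _) hH (by simpa using hA)

theorem NonplanarOn.mono {V : Type} {H H' : SimpleGraph V} {A A' : Set V}
    (h : NonplanarOn H A) (hH : H ≤ H') (hA : A ⊆ A') : NonplanarOn H' A' :=
  h.mono' (fun _ _ _ _ hxy => hH hxy) hA

theorem nonplanarOn_univ {V : Type} {H : SimpleGraph V} :
    NonplanarOn H Set.univ ↔ ¬ IsPlanar H := by
  rw [NonplanarOn, IsPlanar, hasModelOn_univ, hasModelOn_univ]
  tauto

theorem nonplanarOn_iff_induce {V : Type} {H : SimpleGraph V} {A : Set V} :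
    NonplanarOn H A ↔ ¬ IsPlanar (H.induce A) := by
  rw [← nonplanarOn_univ]
  constructor
  · intro h
    obtain ⟨a, ha⟩ : A.Nonempty := by
      rcases h with ⟨f, hf⟩ | ⟨f, hf⟩
      · exact (hf.conn 0).1.mono (hf.subset 0)
      · exact (hf.conn 0).1.mono (hf.subset 0)
    classical
    refine h.map (fun x => if hx : x ∈ A then ⟨x, hx⟩ else ⟨a, ha⟩) ?_ ?_ (Set.subset_univ _)
    · intro x hx y hy hxy
      simpa [hx, hy] using hxy
    · intro x hx y hy hxy
      simpa [hx, hy] using hxy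
  · intro h
    exact h.map Subtype.val Subtype.val_injective.injOn (fun x _ y _ hxy => by simpa using hxy)
      (by simp)

theorem IsModelOn.card_le {V W : Type} [Finite V] [Fintype W] {K : SimpleGraph W}
    {H : SimpleGraph V} {A : Set V} {f : W → Set V} (hf : IsModelOn K H A f) :
    Fintype.card W ≤ A.ncard := by
  choose g hg using fun w => (hf.conn w).1
  have hinj : Function.Injective g := fun w w' h => hf.disj w w' (g w) (hg w) (h ▸ hg w')
  rw [← Nat.card_eq_fintype_card, ← Set.ncard_univ, ← Set.ncard_image_of_injective _ hinj]
  exact Set.ncard_le_ncard (by rintro _ ⟨w, -, rfl⟩; exact hf.subset w (hg w)) A.toFinite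

theorem NonplanarOn.five_le_ncard {V : Type} [Finite V] {H : SimpleGraph V} {A : Set V}
    (h : NonplanarOn H A) : 5 ≤ A.ncard := by
  rcases h with ⟨f, hf⟩ | ⟨f, hf⟩
  · simpa using hf.card_le
  · exact le_trans (by simp) hf.card_le

/-- `K` stays connected, and every vertex keeps a neighbour, when two vertices are deleted. -/
structure IsRobust {W : Type} (K : SimpleGraph W) : Prop where
  conn : ∀ p q w w', w ≠ p → w ≠ q → w' ≠ p → w' ≠ q →
    w = w' ∨ K.Adj w w' ∨ ∃ z, z ≠ p ∧ z ≠ q ∧ K.Adj w z ∧ K.Adj z w'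
  nbr : ∀ p q w, ∃ z, z ≠ p ∧ z ≠ q ∧ K.Adj w z

theorem K5_adj {i j : Fin 5} : K5.Adj i j ↔ i ≠ j := Iff.rfl

theorem K33_adj {i j : Fin 6} : K33.Adj i j ↔ (i.val < 3 ↔ 3 ≤ j.val) := by
  rw [K33, fromRel_adj]
  constructor
  · rintro ⟨-, h | h⟩ <;> omega
  · intro h
    refine ⟨fun hij => by subst hij; omega, by omega⟩

theorem isRobust_K5 : IsRobust K5 := by
  constructor
  · simp only [K5_adj]
    intro p q w w' _ _ _ _
    tauto
  · simp only [K5_adj]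
    decide

theorem isRobust_K33 : IsRobust K33 := by
  constructor
  · simp only [K33_adj]
    decide
  · simp only [K33_adj]
    decide

theorem IsModelOn.restrict {V W : Type} {K : SimpleGraph W} (hK : IsRobust K)
    {H : SimpleGraph V} {A A₁ A₂ : Set V} {f : W → Set V} (hf : IsModelOn K H A f)
    (hcov : A ⊆ A₁ ∪ A₂) (hsep : ∀ x ∈ A₁, ∀ y ∈ A₂, H.Adj x y → x ∈ A₂ ∨ y ∈ A₁)
    (hclique : ∀ x ∈ A₁ ∩ A₂, ∀ y ∈ A₁ ∩ A₂, x ≠ y → H.Adj x y) {p q : W}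
    (hpq : ∀ w, w ≠ p → w ≠ q → f w ⊆ A₁ \ A₂) :
    HasModelOn K H A₁ := by
  have hone : ∀ w, (f w ∩ (A₁ ∩ A₂)).Nonempty ∨ f w ⊆ A₁ \ A₂ := by
    intro w
    rw [or_iff_not_imp_left, Set.not_nonempty_iff_eq_empty]
    intro hempty
    have hno : ∀ x ∈ f w, x ∈ A₁ → x ∉ A₂ := fun x hx h1 h2 => by
      have : x ∈ f w ∩ (A₁ ∩ A₂) := ⟨hx, h1, h2⟩
      rw [hempty] at this; exact this
    obtain ⟨z, hzp, hzq, hwz⟩ := hK.nbr p q w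
    obtain ⟨u, hu, v, hv, huv⟩ := hf.adj w z hwz
    have hv1 := hpq z hzp hzq hv
    have hu1 : u ∈ A₁ := by
      rcases hcov (hf.subset _ hu) with h | h
      · exact h
      · exact ((hsep v hv1.1 u h huv.symm).resolve_left hv1.2)
    have hsub := (hf.conn w).2 A₁ ⟨u, hu, hu1⟩ (by
      intro x hx hx1 y hy hxy
      rcases hcov (hf.subset _ hy) with h | h
      · exact h
      · exact (hsep x hx1 y h hxy).resolve_left (hno x hx hx1))
    exact fun x hx => ⟨hsub hx, hno x hx (hsub hx)⟩
  refine ⟨fun w => f w ∩ A₁, fun w => Set.inter_subset_right, fun w => ?_,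
    fun w w' x hx hx' => hf.disj w w' x hx.1 hx'.1, fun w w' hww' => ?_⟩
  · refine (hf.conn w).inter_of_clique ((hf.subset w).trans hcov) hsep hclique ?_
    rcases hone w with ⟨x, hx, hx1, -⟩ | h
    · exact ⟨x, hx, hx1⟩
    · obtain ⟨x, hx⟩ := (hf.conn w).1
      exact ⟨x, hx, (h hx).1⟩
  · obtain ⟨u, hu, v, hv, huv⟩ := hf.adj w w' hww'
    have side : ∀ {x y}, x ∈ A₁ \ A₂ → y ∈ A → H.Adj x y → y ∈ A₁ := by
      intro x y hx hy hxy
      rcases hcov hy with h | h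
      · exact h
      · exact (hsep x hx.1 y h hxy).resolve_left hx.2
    rcases hone w with ⟨s, hs, hs1⟩ | h
    · rcases hone w' with ⟨t, ht, ht1⟩ | h'
      · refine ⟨s, ⟨hs, hs1.1⟩, t, ⟨ht, ht1.1⟩, hclique s hs1 t ht1 ?_⟩
        rintro rfl
        exact K.ne_of_adj hww' (hf.disj w w' s hs ht)
      · exact ⟨u, ⟨hu, side (h' hv) (hf.subset _ hu) huv.symm⟩, v, ⟨hv, (h' hv).1⟩, huv⟩
    · exact ⟨u, ⟨hu, (h hu).1⟩, v, ⟨hv, side (h hu) (hf.subset _ hv) huv⟩, huv⟩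

/-- A robust graph with a model across a separation of order at most two whose separator is a
clique has a model on one side. -/
theorem HasModelOn.of_separation {V W : Type} [Nonempty W] {K : SimpleGraph W} (hK : IsRobust K)
    {H : SimpleGraph V} {A A₁ A₂ : Set V} {c d : V} (h : HasModelOn K H A)
    (hcov : A ⊆ A₁ ∪ A₂) (hsep : ∀ x ∈ A₁, ∀ y ∈ A₂, H.Adj x y → x ∈ A₂ ∨ y ∈ A₁)
    (hcd : A₁ ∩ A₂ ⊆ {c, d}) (hadj : c ≠ d → H.Adj c d) :
    HasModelOn K H A₁ ∨ HasModelOn K H A₂ := by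
  obtain ⟨f, hf⟩ := h
  have hclique : ∀ x ∈ A₁ ∩ A₂, ∀ y ∈ A₁ ∩ A₂, x ≠ y → H.Adj x y := by
    intro x hx y hy hxy
    rcases hcd hx with rfl | rfl <;> rcases hcd hy with rfl | rfl
    · exact absurd rfl hxy
    · exact hadj hxy
    · exact (hadj hxy.symm).symm
    · exact absurd rfl hxy
  have hpick : ∀ x : V, ∃ p : W, ∀ w, x ∈ f w → w = p := by
    intro x
    by_cases hx : ∃ p, x ∈ f p
    · obtain ⟨p, hp⟩ := hx
      exact ⟨p, fun w hw => hf.disj w p x hw hp⟩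
    · exact ⟨Classical.arbitrary W, fun w hw => absurd ⟨w, hw⟩ hx⟩
  obtain ⟨p, hp⟩ := hpick c
  obtain ⟨q, hq⟩ := hpick d
  have havoid : ∀ w, w ≠ p → w ≠ q → ∀ x ∈ f w, x ∈ A₁ → x ∉ A₂ := by
    intro w hwp hwq x hx h1 h2
    rcases hcd ⟨h1, h2⟩ with rfl | rfl
    · exact hwp (hp w hx)
    · exact hwq (hq w hx)
  have hside : ∀ w, w ≠ p → w ≠ q → f w ⊆ A₁ \ A₂ ∨ f w ⊆ A₂ \ A₁ := by
    intro w hwp hwq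
    by_cases h1 : ∃ x ∈ f w, x ∈ A₁
    · left
      have hsub := (hf.conn w).2 A₁ h1 (by
        intro x hx hx1 y hy hxy
        rcases hcov (hf.subset _ hy) with h | h
        · exact h
        · exact (hsep x hx1 y h hxy).resolve_left (havoid w hwp hwq x hx hx1))
      exact fun x hx => ⟨hsub hx, havoid w hwp hwq x hx (hsub hx)⟩
    · right
      push Not at h1
      exact fun x hx => ⟨(hcov (hf.subset _ hx)).resolve_left (h1 x hx), h1 x hx⟩
  have hstep : ∀ w w', w ≠ p → w ≠ q → w' ≠ p → w' ≠ q → K.Adj w w' → f w ⊆ A₁ \ A₂ →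
      f w' ⊆ A₁ \ A₂ := by
    intro w w' hwp hwq hwp' hwq' hww' hw
    obtain ⟨u, hu, v, hv, huv⟩ := hf.adj w w' hww'
    refine (hside w' hwp' hwq').resolve_right fun h => ?_
    rcases hsep u (hw hu).1 v (h hv).1 huv with h' | h'
    · exact (hw hu).2 h'
    · exact (h hv).2 h'
  obtain ⟨r, hrp, hrq, -⟩ := hK.nbr p q p
  by_cases hr : f r ⊆ A₁ \ A₂
  · left
    refine hf.restrict hK hcov hsep hclique (p := p) (q := q) fun w hwp hwq => ?_
    rcases hK.conn p q r w hrp hrq hwp hwq with rfl | h | ⟨z, hzp, hzq, h1, h2⟩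
    · exact hr
    · exact hstep r w hrp hrq hwp hwq h hr
    · exact hstep z w hzp hzq hwp hwq h2 (hstep r z hrp hrq hzp hzq h1 hr)
  · right
    refine hf.restrict hK (by rwa [Set.union_comm]) (fun x hx y hy hxy =>
      (hsep y hy x hx hxy.symm).symm) (by rwa [Set.inter_comm]) (p := p) (q := q)
      fun w hwp hwq => (hside w hwp hwq).resolve_left fun hw => hr ?_
    rcases hK.conn p q w r hwp hwq hrp hrq with rfl | h | ⟨z, hzp, hzq, h1, h2⟩
    · exact hw
    · exact hstep w r hwp hwq hrp hrq h hw
    · exact hstep z r hzp hzq hrp hrq h2 (hstep w z hwp hwq hzp hzq h1 hw)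

theorem NonplanarOn.of_separation {V : Type} {H : SimpleGraph V} {A A₁ A₂ : Set V} {c d : V}
    (h : NonplanarOn H A) (hcov : A ⊆ A₁ ∪ A₂)
    (hsep : ∀ x ∈ A₁, ∀ y ∈ A₂, H.Adj x y → x ∈ A₂ ∨ y ∈ A₁)
    (hcd : A₁ ∩ A₂ ⊆ {c, d}) (hadj : c ≠ d → H.Adj c d) :
    NonplanarOn H A₁ ∨ NonplanarOn H A₂ := by
  rcases h with h | h
  · exact (h.of_separation isRobust_K5 hcov hsep hcd hadj).imp Or.inl Or.inl
  · exact (h.of_separation isRobust_K33 hcov hsep hcd hadj).imp Or.inr Or.inr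

theorem NonplanarOn.of_cutvertex {V : Type} {H : SimpleGraph V} {A A₁ A₂ : Set V} {c : V}
    (h : NonplanarOn H A) (hcov : A ⊆ A₁ ∪ A₂)
    (hsep : ∀ x ∈ A₁, ∀ y ∈ A₂, H.Adj x y → x ∈ A₂ ∨ y ∈ A₁)
    (hc : A₁ ∩ A₂ ⊆ {c}) : NonplanarOn H A₁ ∨ NonplanarOn H A₂ :=
  h.of_separation (c := c) (d := c) hcov hsep (by simpa using hc) fun h => absurd rfl h

/-- A connected set through `a` with a neighbour of `b` replaces the edge `ab` in a model. -/
theorem IsModelOn.of_edge {V W : Type} {K : SimpleGraph W} {H H' : SimpleGraph V}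
    {A A' Q : Set V} {f : W → Set V} {a b : V} (hf : IsModelOn K H A f)
    (hH : ∀ x ∈ A, ∀ y ∈ A, H.Adj x y → H'.Adj x y ∨ s(x, y) = s(a, b))
    (hA : A ⊆ A') (hQA : Q ⊆ A') (hQ : ConnectedOn H' Q) (haQ : a ∈ Q)
    (hint : ∀ x ∈ Q, x ∈ A → x = a) (hb : ∃ y ∈ Q, H'.Adj y b) :
    HasModelOn K H' A' := by
  obtain ⟨y, hyQ, hyb⟩ := hb
  let g : W → Set V := fun w => {x | x ∈ f w ∨ (x ∈ Q ∧ a ∈ f w)}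
  have hg : ∀ w x, x ∈ g w ↔ x ∈ f w ∨ (x ∈ Q ∧ a ∈ f w) := fun _ _ => Iff.rfl
  have hor : ∀ {x z}, s(x, z) = s(a, b) → (x = a ∧ z = b) ∨ (x = b ∧ z = a) := by
    intro x z h; simpa using h
  refine ⟨g, fun w => ?_, fun w => ?_, ?_, ?_⟩
  · rintro x (hx | ⟨hx, -⟩)
    · exact hA (hf.subset w hx)
    · exact hQA hx
  · obtain ⟨r, hr⟩ := (hf.conn w).1
    refine ⟨⟨r, Or.inl hr⟩, ?_⟩
    rintro P ⟨z, hz, hzP⟩ hcl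
    have hQP : a ∈ f w → (∃ t ∈ Q, t ∈ P) → Q ⊆ P := fun haw ht => hQ.2 P ht
      fun s hs hsP t ht hst => hcl s (Or.inr ⟨hs, haw⟩) hsP t (Or.inr ⟨ht, haw⟩) hst
    have hfP : (∃ t ∈ f w, t ∈ P) → f w ⊆ P := by
      intro ht
      refine (hf.conn w).2 P ht fun s hs hsP t ht hst => ?_
      rcases hH s (hf.subset w hs) t (hf.subset w ht) hst with h | h
      · exact hcl s (Or.inl hs) hsP t (Or.inl ht) h
      · rcases hor h with ⟨rfl, rfl⟩ | ⟨rfl, rfl⟩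
        · exact hcl y (Or.inr ⟨hyQ, hs⟩) (hQP hs ⟨s, haQ, hsP⟩ hyQ) t (Or.inl ht) hyb
        · exact hQP ht ⟨y, hyQ, hcl s (Or.inl hs) hsP y (Or.inr ⟨hyQ, ht⟩) hyb.symm⟩ haQ
    have hf' : f w ⊆ P := by
      rcases hz with hz | ⟨hz, haw⟩
      · exact hfP ⟨z, hz, hzP⟩
      · exact hfP ⟨a, haw, hQP haw ⟨z, hz, hzP⟩ haQ⟩
    rintro x (hx | ⟨hx, haw⟩)
    · exact hf' hx
    · exact hQP haw ⟨a, haQ, hf' haw⟩ hx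
  · rintro w w' x (hx | ⟨hx, haw⟩) (hx' | ⟨hx', haw'⟩)
    · exact hf.disj w w' x hx hx'
    · obtain rfl := hint x hx' (hf.subset w hx)
      exact hf.disj w w' x hx haw'
    · obtain rfl := hint x hx (hf.subset w' hx')
      exact hf.disj w w' x haw hx'
    · exact hf.disj w w' a haw haw'
  · intro w w' hww'
    obtain ⟨s, hs, t, ht, hst⟩ := hf.adj w w' hww'
    rcases hH s (hf.subset w hs) t (hf.subset w' ht) hst with h | h
    · exact ⟨s, Or.inl hs, t, Or.inl ht, h⟩
    · rcases hor h with ⟨rfl, rfl⟩ | ⟨rfl, rfl⟩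
      · exact ⟨y, Or.inr ⟨hyQ, hs⟩, t, Or.inl ht, hyb⟩
      · exact ⟨s, Or.inl hs, y, Or.inr ⟨hyQ, ht⟩, hyb.symm⟩

theorem NonplanarOn.of_edge {V : Type} {H H' : SimpleGraph V} {A A' Q : Set V} {a b : V}
    (h : NonplanarOn H A)
    (hH : ∀ x ∈ A, ∀ y ∈ A, H.Adj x y → H'.Adj x y ∨ s(x, y) = s(a, b))
    (hA : A ⊆ A') (hQA : Q ⊆ A') (hQ : ConnectedOn H' Q) (haQ : a ∈ Q)
    (hint : ∀ x ∈ Q, x ∈ A → x = a) (hb : ∃ y ∈ Q, H'.Adj y b) : NonplanarOn H' A' :=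
  h.imp (fun ⟨_, hf⟩ => hf.of_edge hH hA hQA hQ haQ hint hb)
    (fun ⟨_, hf⟩ => hf.of_edge hH hA hQA hQ haQ hint hb)

/-! ### Kuratowski subgraphs are nonplanar -/

theorem subdivideEdge_adj_some {W : Type} {H : SimpleGraph W} {u v x y : W} :
    (subdivideEdge H u v).Adj (some x) (some y) ↔ H.Adj x y ∧ s(x, y) ≠ s(u, v) := by
  rw [subdivideEdge, fromRel_adj]
  constructor
  · rintro ⟨-, h | h⟩
    · obtain ⟨a, b, ha, hb, hab, hne⟩ | ⟨h, -⟩ := h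
      · cases ha; cases hb; exact ⟨hab, hne⟩
      · cases h
    · obtain ⟨a, b, ha, hb, hab, hne⟩ | ⟨h, -⟩ := h
      · cases ha; cases hb; exact ⟨hab.symm, by rwa [Sym2.eq_swap]⟩
      · cases h
  · rintro ⟨h, hne⟩
    exact ⟨by simpa using h.ne, Or.inl (Or.inl ⟨x, y, rfl, rfl, h, hne⟩)⟩

theorem subdivideEdge_adj_none {W : Type} {H : SimpleGraph W} {u v y : W} :
    (subdivideEdge H u v).Adj none (some y) ↔ y = u ∨ y = v := by
  rw [subdivideEdge, fromRel_adj]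
  simp

theorem HasModelOn.subdivideEdge {W U : Type} {K : SimpleGraph U} {H : SimpleGraph W}
    (h : HasModelOn K H Set.univ) (u v : W) :
    HasModelOn K (subdivideEdge H u v) Set.univ := by
  obtain ⟨f, hf⟩ := h
  let g : U → Set (Option W) := fun w => {x | (∃ y ∈ f w, x = some y) ∨ (x = none ∧ u ∈ f w)}
  have hsome : ∀ {w y}, some y ∈ g w ↔ y ∈ f w := by intro w y; simp [g]
  have hnone : ∀ {w}, none ∈ g w ↔ u ∈ f w := by intro w; simp [g]
  have hu : (_root_.subdivideEdge H u v).Adj none (some u) :=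
    subdivideEdge_adj_none.2 (Or.inl rfl)
  have hv : (_root_.subdivideEdge H u v).Adj none (some v) :=
    subdivideEdge_adj_none.2 (Or.inr rfl)
  have hcases : ∀ {s t}, H.Adj s t → (_root_.subdivideEdge H u v).Adj (some s) (some t) ∨
      (s = u ∧ t = v) ∨ (s = v ∧ t = u) := by
    intro s t hst
    by_cases hne : s(s, t) = s(u, v)
    · exact Or.inr (by simpa using hne)
    · exact Or.inl (subdivideEdge_adj_some.2 ⟨hst, hne⟩)
  refine ⟨g, fun w => Set.subset_univ _, fun w => ?_, ?_, ?_⟩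
  · obtain ⟨r, hr⟩ := (hf.conn w).1
    refine ⟨⟨some r, hsome.2 hr⟩, ?_⟩
    intro P hP hcl
    have hfP : (∃ y ∈ f w, some y ∈ P) → ∀ y ∈ f w, some y ∈ P := by
      intro hy
      refine (hf.conn w).2 (some ⁻¹' P) hy fun s hs hsP t ht hst => ?_
      rcases hcases hst with h | ⟨rfl, rfl⟩ | ⟨rfl, rfl⟩
      · exact hcl _ (hsome.2 hs) hsP _ (hsome.2 ht) h
      · exact hcl none (hnone.2 hs) (hcl _ (hsome.2 hs) hsP _ (hnone.2 hs) hu.symm) _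
          (hsome.2 ht) hv
      · exact hcl none (hnone.2 ht) (hcl _ (hsome.2 hs) hsP _ (hnone.2 ht) hv.symm) _
          (hsome.2 ht) hu
    have hall : ∀ y ∈ f w, some y ∈ P := by
      obtain ⟨z | z, hz, hzP⟩ := hP
      · exact hfP ⟨u, hnone.1 hz, hcl none hz hzP _ (hsome.2 (hnone.1 hz)) hu⟩
      · exact hfP ⟨z, hsome.1 hz, hzP⟩
    rintro (_ | y) hy
    · exact hcl _ (hsome.2 (hnone.1 hy)) (hall u (hnone.1 hy)) none hy hu.symm
    · exact hall y (hsome.1 hy)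
  · rintro w w' (_ | y) hx hx'
    · exact hf.disj w w' u (hnone.1 hx) (hnone.1 hx')
    · exact hf.disj w w' y (hsome.1 hx) (hsome.1 hx')
  · intro w w' hww'
    obtain ⟨s, hs, t, ht, hst⟩ := hf.adj w w' hww'
    rcases hcases hst with h | ⟨rfl, rfl⟩ | ⟨rfl, rfl⟩
    · exact ⟨_, hsome.2 hs, _, hsome.2 ht, h⟩
    · exact ⟨none, hnone.2 hs, _, hsome.2 ht, hv⟩
    · exact ⟨_, hsome.2 hs, none, hnone.2 ht, hv.symm⟩

theorem HasModelOn.of_iso {V V' U : Type} {K : SimpleGraph U} {H : SimpleGraph V}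
    {H' : SimpleGraph V'} (h : HasModelOn K H Set.univ) (φ : H ≃g H') :
    HasModelOn K H' Set.univ := by
  obtain ⟨f, hf⟩ := h
  exact ⟨_, (hf.map φ φ.injective.injOn fun x _ y _ hxy => φ.map_rel_iff.2 hxy).mono_set
    (Set.subset_univ _)⟩

theorem hasModelOn_self {U : Type} (K : SimpleGraph U) : HasModelOn K K Set.univ :=
  ⟨fun w => {w}, fun _ => Set.subset_univ _, fun w => connectedOn_singleton K w,
    fun _ _ _ hx hx' => hx.symm.trans hx', fun w w' h => ⟨w, rfl, w', rfl, h⟩⟩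

theorem IsSubdivision.hasModelOn {U W : Type} {K : SimpleGraph U} {H : SimpleGraph W}
    (h : IsSubdivision K H) : HasModelOn K H Set.univ := by
  induction h with
  | of_iso φ => exact (hasModelOn_self _).of_iso φ
  | step _ _ φ ih => exact (ih.subdivideEdge _ _).of_iso φ

theorem IsKuratowski.nonplanarOn {V : Type} {G G' : SimpleGraph V} {H : G.Subgraph}
    (hH : IsKuratowski H) (hle : ∀ x y, H.Adj x y → G'.Adj x y) : NonplanarOn G' H.verts := by
  have h : NonplanarOn H.coe Set.univ := hH.imp (·.hasModelOn) (·.hasModelOn)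
  exact h.map Subtype.val Subtype.val_injective.injOn
    (fun x _ y _ hxy => hle _ _ (by simpa using hxy)) (by simp)

/-! ### Kuratowski subdivisions in nonplanar graphs -/

/-- `X` contains a subdivision of `K₅` or `K_{3,3}` on vertices of `A`. -/
def HasKuratowskiOn {V : Type} (X : SimpleGraph V) (A : Set V) : Prop :=
  ∃ B ⊆ A, ∃ D ≤ X, IsSubdivision K5 (D.induce B) ∨ IsSubdivision K33 (D.induce B)

section Critical

variable {V W : Type} {K : SimpleGraph W} {X : SimpleGraph V} {A : Set V} {f : W → Set V}

theorem IsModelOn.cross_edge_unique (hf : IsModelOn K X A f)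
    (hcrit : ∀ x y, x ∈ A → y ∈ A → X.Adj x y → ¬ HasModelOn K (X.deleteEdges {s(x, y)}) A)
    {w w' : W} {x y : V} (hw : w ≠ w') (hx : x ∈ f w) (hy : y ∈ f w') (hxy : X.Adj x y) :
    K.Adj w w' ∧ ∀ x₁ ∈ f w, ∀ y₁ ∈ f w', X.Adj x₁ y₁ → x₁ = x ∧ y₁ = y := by
  have hdel : ∀ {s t}, X.Adj s t → s(s, t) ≠ s(x, y) → (X.deleteEdges {s(x, y)}).Adj s t := by
    intro s t h h'
    simpa [deleteEdges_adj, h] using h'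
  have hor : ∀ {s t}, s(s, t) = s(x, y) → (s = x ∧ t = y) ∨ (s = y ∧ t = x) := by
    intro s t h; simpa using h
  have key : (∀ p p', K.Adj p p' → ∃ u ∈ f p, ∃ v ∈ f p', X.Adj u v ∧ s(u, v) ≠ s(x, y)) →
      False := by
    intro h
    refine hcrit x y (hf.subset _ hx) (hf.subset _ hy) hxy ⟨f, hf.subset, fun p => ?_,
      hf.disj, fun p p' hpp' => ?_⟩
    · refine (hf.conn p).mono fun s hs t ht hst => hdel hst fun h => hw ?_
      rcases hor h with ⟨rfl, rfl⟩ | ⟨rfl, rfl⟩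
      · exact (hf.disj _ _ _ hx hs).trans (hf.disj _ _ _ ht hy)
      · exact (hf.disj _ _ _ hx ht).trans (hf.disj _ _ _ hs hy)
    · obtain ⟨u, hu, v, hv, huv, hne⟩ := h p p' hpp'
      exact ⟨u, hu, v, hv, hdel huv hne⟩
  refine ⟨?_, ?_⟩
  · by_contra hK
    refine key fun p p' hpp' => ?_
    obtain ⟨u, hu, v, hv, huv⟩ := hf.adj p p' hpp'
    refine ⟨u, hu, v, hv, huv, fun h => hK ?_⟩
    rcases hor h with ⟨rfl, rfl⟩ | ⟨rfl, rfl⟩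
    · rwa [hf.disj _ _ _ hx hu, hf.disj _ _ _ hy hv]
    · rw [hf.disj _ _ _ hx hv, hf.disj _ _ _ hy hu]
      exact hpp'.symm
  · intro x₁ hx₁ y₁ hy₁ h₁
    by_contra hne
    have hne' : s(x₁, y₁) ≠ s(x, y) := by
      intro h
      rcases hor h with h | ⟨rfl, rfl⟩
      · exact hne h
      · exact hw (hf.disj _ _ _ hx₁ hy)
    refine key fun p p' hpp' => ?_
    obtain ⟨u, hu, v, hv, huv⟩ := hf.adj p p' hpp'
    by_cases h : s(u, v) = s(x, y)
    · rcases hor h with ⟨rfl, rfl⟩ | ⟨rfl, rfl⟩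
      · obtain rfl := hf.disj _ _ _ hx hu
        obtain rfl := hf.disj _ _ _ hy hv
        exact ⟨x₁, hx₁, y₁, hy₁, h₁, hne'⟩
      · obtain rfl := hf.disj _ _ _ hx hv
        obtain rfl := hf.disj _ _ _ hy hu
        exact ⟨y₁, hy₁, x₁, hx₁, h₁.symm, by rwa [Sym2.eq_swap]⟩
    · exact ⟨u, hu, v, hv, huv, h⟩

theorem IsModelOn.inner_edge_unique (hf : IsModelOn K X A f)
    (hcrit : ∀ x y, x ∈ A → y ∈ A → X.Adj x y → ¬ HasModelOn K (X.deleteEdges {s(x, y)}) A)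
    {w : W} {x y z : V} (hx : x ∈ f w) (hconn : ConnectedOn X (f w \ {x}))
    (hy : y ∈ f w) (hz : z ∈ f w) (hxy : X.Adj x y) (hxz : X.Adj x z) : y = z := by
  by_contra hyz
  have hdel : ∀ {s t}, X.Adj s t → s(s, t) ≠ s(x, y) → (X.deleteEdges {s(x, y)}).Adj s t := by
    intro s t h h'
    simpa [deleteEdges_adj, h] using h'
  have hor : ∀ {s t}, s(s, t) = s(x, y) → (s = x ∧ t = y) ∨ (s = y ∧ t = x) := by
    intro s t h; simpa using h
  refine hcrit x y (hf.subset _ hx) (hf.subset _ hy) hxy ⟨f, hf.subset, fun p => ?_,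
      hf.disj, fun p p' hpp' => ?_⟩
  · by_cases hp : p = w
    · subst hp
      have h1 : ConnectedOn (X.deleteEdges {s(x, y)}) (f p \ {x}) :=
        hconn.mono fun s hs t ht hst => hdel hst fun h => by
          rcases hor h with ⟨rfl, rfl⟩ | ⟨rfl, rfl⟩
          · exact hs.2 rfl
          · exact ht.2 rfl
      have h2 := h1.union_of_adj (connectedOn_singleton _ x) ⟨z, ⟨hz, hxz.ne'⟩, x, rfl,
        Or.inr (hdel hxz.symm fun h => by
          rcases hor h with ⟨rfl, -⟩ | ⟨rfl, -⟩
          · exact hxz.ne rfl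
          · exact hyz rfl)⟩
      rwa [Set.sdiff_union_of_subset (by simpa using hx)] at h2
    · refine (hf.conn p).mono fun s hs t ht hst => hdel hst fun h => hp ?_
      rcases hor h with ⟨rfl, rfl⟩ | ⟨rfl, rfl⟩
      · exact hf.disj _ _ _ hs hx
      · exact hf.disj _ _ _ ht hx
  · obtain ⟨u, hu, v, hv, huv⟩ := hf.adj p p' hpp'
    refine ⟨u, hu, v, hv, hdel huv fun h => K.ne_of_adj hpp' ?_⟩
    rcases hor h with ⟨rfl, rfl⟩ | ⟨rfl, rfl⟩
    · exact (hf.disj _ _ _ hu hx).trans (hf.disj _ _ _ hy hv)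
    · exact (hf.disj _ _ _ hu hy).trans (hf.disj _ _ _ hx hv)

theorem IsModelOn.exists_of_mem (hf : IsModelOn K X A f)
    (hcrit : ∀ y ∈ A, ¬ HasModelOn K X (A \ {y})) {y : V} (hy : y ∈ A) : ∃ w, y ∈ f w := by
  by_contra! hno
  exact hcrit y hy ⟨f, fun w x hx => ⟨hf.subset w hx, fun h => hno w (h ▸ hx)⟩, hf.conn,
    hf.disj, hf.adj⟩

theorem IsModelOn.exists_two_cross_edges (hf : IsModelOn K X A f)
    (hcritV : ∀ y ∈ A, ¬ HasModelOn K X (A \ {y}))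
    (hcrit : ∀ x y, x ∈ A → y ∈ A → X.Adj x y → ¬ HasModelOn K (X.deleteEdges {s(x, y)}) A)
    (hdeg : ∀ y ∈ A, ∀ p q, ∃ z ∈ A, X.Adj y z ∧ z ≠ p ∧ z ≠ q)
    {w : W} {x : V} (hx : x ∈ f w) (hconn : ConnectedOn X (f w \ {x})) :
    ∃ w₁ w₂, w₁ ≠ w₂ ∧ w ≠ w₁ ∧ w ≠ w₂ ∧ (∃ y ∈ f w₁, X.Adj x y) ∧ ∃ y ∈ f w₂, X.Adj x y := by
  obtain ⟨r, hr⟩ := hconn.1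
  obtain ⟨x', -, hx', y₀, hy₀, -, hxy₀⟩ := (hf.conn w).exists_adj_boundary (P := {x})
    ⟨x, hx, rfl⟩ ⟨r, hr⟩
  rw [Set.mem_singleton_iff] at hx'
  subst hx'
  have hout : ∀ {z w'}, X.Adj x' z → z ≠ y₀ → z ∈ f w' → w ≠ w' := by
    rintro z w' hz hne hzw rfl
    exact hne (hf.inner_edge_unique hcrit hx hconn hzw hy₀ hz hxy₀)
  obtain ⟨z₁, hz₁, hxz₁, hne₁, -⟩ := hdeg x' (hf.subset _ hx) y₀ y₀
  obtain ⟨z₂, hz₂, hxz₂, hne₂, hne₂'⟩ := hdeg x' (hf.subset _ hx) y₀ z₁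
  obtain ⟨w₁, hw₁⟩ := hf.exists_of_mem hcritV hz₁
  obtain ⟨w₂, hw₂⟩ := hf.exists_of_mem hcritV hz₂
  refine ⟨w₁, w₂, ?_, hout hxz₁ hne₁ hw₁, hout hxz₂ hne₂ hw₂, ⟨z₁, hw₁, hxz₁⟩, z₂, hw₂, hxz₂⟩
  rintro rfl
  exact hne₂' ((hf.cross_edge_unique hcrit (hout hxz₁ hne₁ hw₁) hx hw₁ hxz₁).2
    x' hx z₂ hw₂ hxz₂).2

/-- In a critical model, a branch set with two vertices splits into two non-cut vertices, each
incident with two cross edges. -/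
theorem IsModelOn.singleton_or_split [Finite V] (hf : IsModelOn K X A f)
    (hcritV : ∀ y ∈ A, ¬ HasModelOn K X (A \ {y}))
    (hcrit : ∀ x y, x ∈ A → y ∈ A → X.Adj x y → ¬ HasModelOn K (X.deleteEdges {s(x, y)}) A)
    (hdeg : ∀ y ∈ A, ∀ p q, ∃ z ∈ A, X.Adj y z ∧ z ≠ p ∧ z ≠ q) (w : W) :
    (∃ x, f w = {x}) ∨ ∃ w₁ w₂ w₃ w₄, [w, w₁, w₂, w₃, w₄].Nodup ∧
      K.Adj w w₁ ∧ K.Adj w w₂ ∧ K.Adj w w₃ ∧ K.Adj w w₄ ∧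
      ∃ y ∈ f w, ConnectedOn X (f w \ {y}) ∧
        (∃ x ∈ f w \ {y}, (∃ z ∈ f w₁, X.Adj x z) ∧ ∃ z ∈ f w₂, X.Adj x z) ∧
        (∃ z ∈ f w₃, X.Adj y z) ∧ ∃ z ∈ f w₄, X.Adj y z := by
  obtain ⟨r, hr⟩ := (hf.conn w).1
  by_cases hs : ∃ s ∈ f w, s ≠ r
  · right
    obtain ⟨s, hs, hsr⟩ := hs
    obtain ⟨x, hx, hxr, hxc⟩ := (hf.conn w).exists_connectedOn_diff hr hs hsr
    obtain ⟨y, hy, hyx, hyc⟩ := (hf.conn w).exists_connectedOn_diff hx hr hxr.symm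
    obtain ⟨w₁, w₂, h12, hw1, hw2, ⟨z₁, hz₁, h₁⟩, z₂, hz₂, h₂⟩ :=
      hf.exists_two_cross_edges hcritV hcrit hdeg hx hxc
    obtain ⟨w₃, w₄, h34, hw3, hw4, ⟨z₃, hz₃, h₃⟩, z₄, hz₄, h₄⟩ :=
      hf.exists_two_cross_edges hcritV hcrit hdeg hy hyc
    have hne : ∀ {p q z z'}, w ≠ p → z ∈ f p → X.Adj x z → z' ∈ f q → X.Adj y z' → p ≠ q := by
      rintro p q z z' hp hz hxz hz' hyz' rfl
      exact hyx ((hf.cross_edge_unique hcrit hp hx hz hxz).2 y hy z' hz' hyz').1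
    refine ⟨w₁, w₂, w₃, w₄, ?_, (hf.cross_edge_unique hcrit hw1 hx hz₁ h₁).1,
      (hf.cross_edge_unique hcrit hw2 hx hz₂ h₂).1, (hf.cross_edge_unique hcrit hw3 hy hz₃ h₃).1,
      (hf.cross_edge_unique hcrit hw4 hy hz₄ h₄).1, y, hy, hyc,
      ⟨x, ⟨hx, hyx.symm⟩, ⟨z₁, hz₁, h₁⟩, z₂, hz₂, h₂⟩, ⟨z₃, hz₃, h₃⟩, z₄, hz₄, h₄⟩
    simp [h12, h34, hw1, hw2, hw3, hw4, hne hw1 hz₁ h₁ hz₃ h₃, hne hw1 hz₁ h₁ hz₄ h₄,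
      hne hw2 hz₂ h₂ hz₃ h₃, hne hw2 hz₂ h₂ hz₄ h₄]
  · left
    push Not at hs
    exact ⟨r, Set.eq_singleton_iff_unique_mem.2 ⟨hr, hs⟩⟩

theorem IsModelOn.isSubdivision_of_singletons (hf : IsModelOn K X A f)
    (hcritV : ∀ y ∈ A, ¬ HasModelOn K X (A \ {y}))
    (hcrit : ∀ x y, x ∈ A → y ∈ A → X.Adj x y → ¬ HasModelOn K (X.deleteEdges {s(x, y)}) A)
    (hsing : ∀ w, ∃ x, f w = {x}) : IsSubdivision K (X.induce A) := by
  choose φ hφ using hsing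
  have hmem : ∀ w, φ w ∈ f w := fun w => by rw [hφ w]; rfl
  have hbij : Function.Bijective fun w => (⟨φ w, hf.subset w (hmem w)⟩ : A) := by
    refine ⟨fun w w' h => hf.disj w w' (φ w) (hmem w) ?_, fun ⟨y, hy⟩ => ?_⟩
    · rw [Subtype.mk.injEq] at h
      exact h ▸ hmem w'
    · obtain ⟨w, hw⟩ := hf.exists_of_mem hcritV hy
      rw [hφ w] at hw
      exact ⟨w, Subtype.ext (by simpa using hw.symm)⟩
  refine IsSubdivision.of_iso ⟨Equiv.ofBijective _ hbij, ?_⟩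
  intro w w'
  simp only [Equiv.ofBijective_apply, comap_adj, Function.Embedding.subtype_apply]
  constructor
  · intro h
    have hne : w ≠ w' := by rintro rfl; exact h.ne rfl
    exact (hf.cross_edge_unique hcrit hne (hmem w) (hmem w') h).1
  · intro h
    obtain ⟨u, hu, v, hv, huv⟩ := hf.adj w w' h
    rw [hφ, Set.mem_singleton_iff] at hu hv
    rwa [← hu, ← hv]

end Critical

/-- Splitting a branch set of a `K₅` model into two parts of outer degree two yields a `K_{3,3}`
model. -/
theorem IsModelOn.hasModelOn_K33_of_split {V : Type} {X : SimpleGraph V} {A : Set V}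
    {f : Fin 5 → Set V} (hf : IsModelOn K5 X A f) {w w₁ w₂ w₃ w₄ : Fin 5}
    (hnd : [w, w₁, w₂, w₃, w₄].Nodup) {y : V} (hy : y ∈ f w)
    (hyc : ConnectedOn X (f w \ {y}))
    (hx : ∃ x ∈ f w \ {y}, (∃ z ∈ f w₁, X.Adj x z) ∧ ∃ z ∈ f w₂, X.Adj x z)
    (h₃ : ∃ z ∈ f w₃, X.Adj y z) (h₄ : ∃ z ∈ f w₄, X.Adj y z) :
    IsModelOn K33 X A ![f w \ {y}, f w₃, f w₄, {y}, f w₁, f w₂] := by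
  obtain ⟨x, hx, h₁, h₂⟩ := hx
  have hsub : ∀ i, ![f w \ {y}, f w₃, f w₄, {y}, f w₁, f w₂] i ⊆
      f (![w, w₃, w₄, w, w₁, w₂] i) := by
    intro i
    fin_cases i
    · exact Set.sdiff_subset
    · exact subset_rfl
    · exact subset_rfl
    · exact Set.singleton_subset_iff.2 hy
    · exact subset_rfl
    · exact subset_rfl
  have h0 : ∃ z ∈ f w \ {y}, X.Adj z y := by
    obtain ⟨s, hs, hsy, t, ht, hty, hst⟩ := (hf.conn w).exists_adj_boundary (P := {y})
      ⟨y, hy, rfl⟩ ⟨x, hx⟩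
    rw [Set.mem_singleton_iff] at hsy
    subst hsy
    exact ⟨t, ⟨ht, hty⟩, hst.symm⟩
  simp only [List.nodup_cons, List.mem_cons, List.not_mem_nil, or_false, not_or] at hnd
  obtain ⟨⟨h01, h02, h03, h04⟩, ⟨h12, h13, h14⟩, ⟨h23, h24⟩, h34, -⟩ := hnd
  refine ⟨fun i => (hsub i).trans (hf.subset _), ?_, ?_, ?_⟩
  · intro i
    fin_cases i
    exacts [hyc, hf.conn _, hf.conn _, connectedOn_singleton X y, hf.conn _, hf.conn _]
  · intro i j z hi hj
    have hp := hf.disj _ _ z (hsub i hi) (hsub j hj)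
    fin_cases i <;> fin_cases j <;> first
      | rfl
      | (exfalso; simp [h01, h02, h03, h04, h12, h13, h14, h23, h24, h34, Ne.symm h01,
          Ne.symm h02, Ne.symm h03, Ne.symm h04, Ne.symm h12, Ne.symm h13, Ne.symm h14,
          Ne.symm h23, Ne.symm h24, Ne.symm h34] at hp; done)
      | (exfalso; simp at hi hj; tauto)
  · have hadj : ∀ {p q}, p ≠ q → ∃ s ∈ f p, ∃ t ∈ f q, X.Adj s t := fun h => hf.adj _ _ h
    have key : ∀ i j : Fin 6, i.val < 3 → 3 ≤ j.val →
        ∃ s ∈ ![f w \ {y}, f w₃, f w₄, {y}, f w₁, f w₂] i,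
        ∃ t ∈ ![f w \ {y}, f w₃, f w₄, {y}, f w₁, f w₂] j, X.Adj s t := by
      intro i j hi hj
      obtain ⟨z₃, hz₃, h₃⟩ := h₃
      obtain ⟨z₄, hz₄, h₄⟩ := h₄
      obtain ⟨z₀, hz₀, h₀⟩ := h0
      fin_cases i <;> first | (exfalso; simp at hi; done) | skip
      all_goals fin_cases j <;> first | (exfalso; simp at hj; done) | skip
      · exact ⟨z₀, hz₀, y, rfl, h₀⟩
      · exact ⟨x, hx, h₁⟩
      · exact ⟨x, hx, h₂⟩
      · exact ⟨z₃, hz₃, y, rfl, h₃.symm⟩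
      · exact hadj (Ne.symm h13)
      · exact hadj (Ne.symm h23)
      · exact ⟨z₄, hz₄, y, rfl, h₄.symm⟩
      · exact hadj (Ne.symm h14)
      · exact hadj (Ne.symm h24)
    intro i j hij
    rw [K33_adj] at hij
    by_cases hi : i.val < 3
    · exact key i j hi (hij.1 hi)
    · obtain ⟨s, hs, t, ht, hst⟩ := key j i (by omega) (by omega)
      exact ⟨t, ht, s, hs, hst.symm⟩

theorem K33_not_four_nbrs : ∀ w w₁ w₂ w₃ w₄ : Fin 6, [w, w₁, w₂, w₃, w₄].Nodup →
    K33.Adj w w₁ → K33.Adj w w₂ → K33.Adj w w₃ → K33.Adj w w₄ → False := by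
  simp only [K33_adj, List.nodup_cons, List.mem_cons, List.not_mem_nil, or_false, not_or]
  intro w w₁ w₂ w₃ w₄
  simp only [Fin.ext_iff]
  omega

theorem NonplanarOn.hasKuratowskiOn_of_critical {V : Type} [Finite V] {X : SimpleGraph V}
    {A : Set V} (h : NonplanarOn X A) (hcritV : ∀ y ∈ A, ¬ NonplanarOn X (A \ {y}))
    (hcrit : ∀ x y, x ∈ A → y ∈ A → X.Adj x y → ¬ NonplanarOn (X.deleteEdges {s(x, y)}) A)
    (hdeg : ∀ y ∈ A, ∀ p q, ∃ z ∈ A, X.Adj y z ∧ z ≠ p ∧ z ≠ q) : HasKuratowskiOn X A := by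
  have hV5 := fun y hy hm => hcritV y hy (Or.inl hm)
  have hV33 := fun y hy hm => hcritV y hy (Or.inr hm)
  have hE5 := fun x y hx hy hxy hm => hcrit x y hx hy hxy (Or.inl hm)
  have hE33 := fun x y hx hy hxy hm => hcrit x y hx hy hxy (Or.inr hm)
  refine ⟨A, subset_rfl, X, le_rfl, ?_⟩
  rcases h with ⟨f, hf⟩ | ⟨f, hf⟩
  · left
    refine hf.isSubdivision_of_singletons hV5 hE5 fun w => ?_
    refine (hf.singleton_or_split hV5 hE5 hdeg w).resolve_right ?_
    rintro ⟨w₁, w₂, w₃, w₄, hnd, -, -, -, -, y, hy, hyc, hx, h₃, h₄⟩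
    have hm := hf.hasModelOn_K33_of_split hnd hy hyc hx h₃ h₄
    obtain ⟨s, hs, t, ht, hst⟩ := hf.adj w₁ w₂ (by
      simp only [List.nodup_cons, List.mem_cons, not_or] at hnd
      exact hnd.2.1.1)
    have := (hm.cross_edge_unique hE33 (w := 4) (w' := 5) (by decide) hs ht hst).1
    rw [K33_adj] at this
    exact absurd this (by decide)
  · right
    refine hf.isSubdivision_of_singletons hV33 hE33 fun w => ?_
    refine (hf.singleton_or_split hV33 hE33 hdeg w).resolve_right ?_
    rintro ⟨w₁, w₂, w₃, w₄, hnd, h1, h2, h3, h4, -⟩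
    exact K33_not_four_nbrs w w₁ w₂ w₃ w₄ hnd h1 h2 h3 h4

/-- Replacing an edge `pq` by a path through a new vertex `y`. -/
theorem IsSubdivision.insert_vertex {V U : Type} {K : SimpleGraph U} {D X : SimpleGraph V}
    {B : Set V} {p q y : V} (h : IsSubdivision K (D.induce B)) (hp : p ∈ B) (hq : q ∈ B)
    (hpq : D.Adj p q) (hy : y ∉ B) (hyp : X.Adj y p) (hyq : X.Adj y q)
    (hle : ∀ s t, D.Adj s t → s(s, t) ≠ s(p, q) → X.Adj s t) :
    ∃ D' ≤ X, IsSubdivision K (D'.induce (insert y B)) := by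
  let D' : SimpleGraph V :=
    { Adj := fun s t => (s ∈ B ∧ t ∈ B ∧ D.Adj s t ∧ s(s, t) ≠ s(p, q)) ∨
        (s = y ∧ (t = p ∨ t = q)) ∨ (t = y ∧ (s = p ∨ s = q))
      symm := ⟨by
        rintro s t (⟨hs, ht, hst, hne⟩ | h | h)
        · exact Or.inl ⟨ht, hs, hst.symm, by rwa [Sym2.eq_swap]⟩
        · exact Or.inr (Or.inr h)
        · exact Or.inr (Or.inl h)⟩
      loopless := ⟨by
        rintro s (⟨-, -, hst, -⟩ | ⟨rfl, rfl | rfl⟩ | ⟨rfl, rfl | rfl⟩)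
        · exact hst.ne rfl
        all_goals contradiction⟩ }
  have hD' : ∀ s t, D'.Adj s t ↔ (s ∈ B ∧ t ∈ B ∧ D.Adj s t ∧ s(s, t) ≠ s(p, q)) ∨
      (s = y ∧ (t = p ∨ t = q)) ∨ (t = y ∧ (s = p ∨ s = q)) := fun _ _ => Iff.rfl
  refine ⟨D', ?_, ?_⟩
  · rintro s t (⟨-, -, hst, hne⟩ | ⟨rfl, rfl | rfl⟩ | ⟨rfl, rfl | rfl⟩)
    exacts [hle s t hst hne, hyp, hyq, hyp.symm, hyq.symm]
  · let g : Option B → (insert y B : Set V) := fun o =>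
      o.elim ⟨y, Or.inl rfl⟩ fun b => ⟨b, Or.inr b.2⟩
    have hg0 : (g none : V) = y := rfl
    have hg1 : ∀ b, (g (some b) : V) = b := fun _ => rfl
    have hney : ∀ b : B, (b : V) ≠ y := fun b hb => hy (hb ▸ b.2)
    have hbij : Function.Bijective g := by
      constructor
      · rintro (_ | b) (_ | b') hbb'
        · rfl
        · exact absurd (congrArg Subtype.val hbb').symm (hney b')
        · exact absurd (congrArg Subtype.val hbb') (hney b)
        · exact congrArg some (Subtype.ext (congrArg Subtype.val hbb' :))
      · rintro ⟨x, rfl | hx⟩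
        · exact ⟨none, rfl⟩
        · exact ⟨some ⟨x, hx⟩, rfl⟩
    have hnone : ∀ b : B, D'.Adj y b ↔ (b : V) = p ∨ (b : V) = q := by
      intro b
      rw [hD']
      have := hney b
      tauto
    refine IsSubdivision.step (H := D.induce B) (u := ⟨p, hp⟩) (v := ⟨q, hq⟩) (by simpa using hpq)
      h ⟨Equiv.ofBijective g hbij, ?_⟩
    rintro (_ | b) (_ | b')
    · simp
    · rw [subdivideEdge_adj_none]
      simpa [g, Subtype.ext_iff] using hnone b'
    · rw [adj_comm, adj_comm (subdivideEdge _ _ _), subdivideEdge_adj_none]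
      simpa [g, Subtype.ext_iff] using hnone b
    · rw [subdivideEdge_adj_some]
      have := hney b
      have := hney b'
      simp only [Equiv.ofBijective_apply, comap_adj, Function.Embedding.subtype_apply, hg1, hD',
        Subtype.coe_prop, Ne, Sym2.eq_iff, Subtype.ext_iff]
      tauto

theorem HasKuratowskiOn.of_edge {V : Type} {X : SimpleGraph V} {A : Set V} {p q y : V}
    (h : HasKuratowskiOn (X ⊔ edge p q) (A \ {y})) (hyA : y ∈ A) (hyp : X.Adj y p)
    (hyq : X.Adj y q) : HasKuratowskiOn X A := by
  obtain ⟨B, hB, D, hD, h⟩ := h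
  have hyB : y ∉ B := fun hy => (hB hy).2 rfl
  have hDX : ∀ s t, D.Adj s t → X.Adj s t ∨ s(s, t) = s(p, q) := by
    intro s t hst
    rcases hD hst with h | h
    · exact Or.inl h
    · rw [edge_adj] at h
      right
      simpa using h.1
  by_cases hpq : p ∈ B ∧ q ∈ B ∧ D.Adj p q
  · obtain ⟨hp, hq, hpq⟩ := hpq
    have hle : ∀ s t, D.Adj s t → s(s, t) ≠ s(p, q) → X.Adj s t := fun s t hst hne =>
      (hDX s t hst).resolve_right hne
    refine ⟨insert y B, Set.insert_subset hyA (hB.trans Set.sdiff_subset), ?_⟩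
    rcases h with h | h
    · obtain ⟨D', hD', h'⟩ := h.insert_vertex hp hq hpq hyB hyp hyq hle
      exact ⟨D', hD', Or.inl h'⟩
    · obtain ⟨D', hD', h'⟩ := h.insert_vertex hp hq hpq hyB hyp hyq hle
      exact ⟨D', hD', Or.inr h'⟩
  · refine ⟨B, hB.trans Set.sdiff_subset, D ⊓ X, inf_le_right, ?_⟩
    have hind : (D ⊓ X).induce B = D.induce B := by
      ext s t
      simp only [comap_adj, Function.Embedding.subtype_apply, inf_adj, and_iff_left_iff_imp]
      intro hst
      refine (hDX s t hst).resolve_right fun heq => hpq ?_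
      rcases Sym2.eq_iff.1 heq with ⟨h1, h2⟩ | ⟨h1, h2⟩
      · exact ⟨h1 ▸ s.2, h2 ▸ t.2, h1 ▸ h2 ▸ hst⟩
      · exact ⟨h2 ▸ t.2, h1 ▸ s.2, h1 ▸ h2 ▸ hst.symm⟩
    rwa [hind]

theorem HasKuratowskiOn.mono {V : Type} {X X' : SimpleGraph V} {A A' : Set V}
    (h : HasKuratowskiOn X A) (hX : X ≤ X') (hA : A ⊆ A') : HasKuratowskiOn X' A' := by
  obtain ⟨B, hB, D, hD, h⟩ := h
  exact ⟨B, hB.trans hA, D, hD.trans hX, h⟩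

theorem NonplanarOn.diff_of_few_nbrs {V : Type} [Finite V] {X : SimpleGraph V} {A : Set V}
    {y c d : V} (h : NonplanarOn X A) (hyA : y ∈ A)
    (hN : ∀ z ∈ A, X.Adj y z → z = c ∨ z = d) (hcd : c ≠ d → X.Adj c d) :
    NonplanarOn X (A \ {y}) := by
  have := h.of_separation (A₁ := A \ {y}) (A₂ := {z | z = y ∨ (z ∈ A ∧ X.Adj y z)}) (c := c)
    (d := d) (fun z hz => by
      by_cases hzy : z = y
      · exact Or.inr (Or.inl hzy)
      · exact Or.inl ⟨hz, hzy⟩)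
    (by
      rintro x hx z (rfl | ⟨hz, hyz⟩) hxz
      · exact Or.inl (Or.inr ⟨hx.1, hxz.symm⟩)
      · exact Or.inr ⟨hz, hyz.ne'⟩)
    (by
      rintro z ⟨⟨-, hzy⟩, rfl | ⟨hz, hyz⟩⟩
      · exact absurd rfl hzy
      · exact hN z hz hyz) hcd
  refine this.resolve_right fun h' => ?_
  have h5 := h'.five_le_ncard
  have hsub : {z | z = y ∨ (z ∈ A ∧ X.Adj y z)} ⊆ ({y, c, d} : Set V) := by
    rintro z (rfl | ⟨hz, hyz⟩)
    · exact Or.inl rfl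
    · exact Or.inr (hN z hz hyz)
  have h3 := Set.ncard_le_ncard hsub (Set.toFinite _)
  have h3' : ({y, c, d} : Set V).ncard ≤ 3 := by
    have h1 := Set.ncard_insert_le y ({c, d} : Set V)
    have h2 := Set.ncard_insert_le c ({d} : Set V)
    rw [Set.ncard_singleton] at h2
    omega
  omega

/-- A nonplanar graph contains a subdivision of `K₅` or `K_{3,3}`. -/
theorem NonplanarOn.hasKuratowskiOn {V : Type} [Finite V] {X : SimpleGraph V} {A : Set V}
    (h : NonplanarOn X A) : HasKuratowskiOn X A := by
  induction hn : A.ncard using Nat.strong_induction_on generalizing X A with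
  | _ n ihA =>
  induction hm : X.edgeSet.ncard using Nat.strong_induction_on generalizing X with
  | _ m ihE =>
  have ihA' : ∀ {Y : SimpleGraph V} {y}, y ∈ A → NonplanarOn Y (A \ {y}) →
      HasKuratowskiOn Y (A \ {y}) := fun hy hY =>
    ihA _ (hn ▸ Set.ncard_sdiff_singleton_lt_of_mem hy) hY rfl
  by_cases hV : ∃ y ∈ A, NonplanarOn X (A \ {y})
  · obtain ⟨y, hy, hXy⟩ := hV
    exact (ihA' hy hXy).mono le_rfl Set.sdiff_subset
  by_cases hE : ∃ x y, x ∈ A ∧ y ∈ A ∧ X.Adj x y ∧ NonplanarOn (X.deleteEdges {s(x, y)}) A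
  · obtain ⟨x, y, -, -, hxy, hXy⟩ := hE
    refine (ihE _ ?_ hXy rfl).mono (deleteEdges_le _) subset_rfl
    rw [← hm, edgeSet_deleteEdges]
    exact Set.ncard_sdiff_singleton_lt_of_mem hxy
  push Not at hV hE
  by_cases hdeg : ∀ y ∈ A, ∀ p q, ∃ z ∈ A, X.Adj y z ∧ z ≠ p ∧ z ≠ q
  · exact h.hasKuratowskiOn_of_critical hV hE hdeg
  push Not at hdeg
  obtain ⟨y, hy, p, q, hN⟩ := hdeg
  replace hN : ∀ z ∈ A, X.Adj y z → z = p ∨ z = q := fun z hz hyz => by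
    have := hN z hz hyz
    tauto
  by_cases hp : X.Adj y p
  · by_cases hq : X.Adj y q
    · have h1 : NonplanarOn (X ⊔ edge p q) (A \ {y}) := by
        refine (h.mono le_sup_left subset_rfl).diff_of_few_nbrs hy ?_ (c := p) (d := q) ?_
        · rintro z hz (hyz | hyz)
          · exact hN z hz hyz
          · rw [edge_adj] at hyz
            tauto
        · intro hpq
          exact Or.inr (by rw [edge_adj]; tauto)
      exact (ihA' hy h1).of_edge hy hp hq
    · refine absurd (h.diff_of_few_nbrs hy (c := p) (d := p) ?_ (fun h => absurd rfl h)) (hV y hy)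
      rintro z hz hyz
      rcases hN z hz hyz with rfl | rfl
      · exact Or.inl rfl
      · exact absurd hyz hq
  · refine absurd (h.diff_of_few_nbrs hy (c := q) (d := q) ?_ (fun h => absurd rfl h)) (hV y hy)
    rintro z hz hyz
    rcases hN z hz hyz with rfl | rfl
    · exact absurd hyz hp
    · exact Or.inl rfl

theorem HasKuratowskiOn.exists_subgraph {V : Type} {X : SimpleGraph V} {A : Set V}
    (h : HasKuratowskiOn X A) : ∃ H : X.Subgraph, IsKuratowski H ∧ H.verts ⊆ A := by
  obtain ⟨B, hB, D, hD, h⟩ := h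
  refine ⟨{ verts := B
            Adj := fun s t => s ∈ B ∧ t ∈ B ∧ D.Adj s t
            adj_sub := fun h => hD h.2.2
            edge_vert := fun h => h.1
            symm := ⟨fun s t ⟨hs, ht, hst⟩ => ⟨ht, hs, hst.symm⟩⟩ }, ?_, hB⟩
  rw [IsKuratowski]
  convert h using 2
  all_goals
    ext s t
    simp

/-! ### Apex obstructions -/

section Obstruction

variable {V : Type} {G : SimpleGraph V}

theorem IsApexObstruction.nonplanarOn_compl (hG : IsApexObstruction G) (x : V) :
    NonplanarOn G {x}ᶜ := by
  rw [nonplanarOn_iff_induce]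
  exact fun h => hG.1 (Or.inr ⟨x, h⟩)

theorem IsApex.exists_not_nonplanarOn {W : Type} [Nonempty W] {H : SimpleGraph W}
    (h : IsApex H) : ∃ x, ¬ NonplanarOn H {x}ᶜ := by
  rcases h with h | ⟨x, h⟩
  · obtain ⟨x⟩ := ‹Nonempty W›
    exact ⟨x, fun hx => nonplanarOn_univ.1 (hx.mono le_rfl (Set.subset_univ _)) h⟩
  · exact ⟨x, fun hx => nonplanarOn_iff_induce.1 hx h⟩

/-- A minor of an apex obstruction on a proper subset of its vertices is apex. -/
theorem IsApexObstruction.exists_not_nonplanarOn_of_minor [Finite V] (hG : IsApexObstruction G)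
    {H : SimpleGraph V} {A : Set V} {r : V} (hr : r ∉ A) (hA : A.Nonempty) (f : V → Set V)
    (hconn : ∀ w ∈ A, ConnectedOn G (f w))
    (hdisj : ∀ w ∈ A, ∀ w' ∈ A, ∀ z ∈ f w, z ∈ f w' → w = w')
    (hadj : ∀ w ∈ A, ∀ w' ∈ A, H.Adj w w' → ∃ s ∈ f w, ∃ t ∈ f w', G.Adj s t) :
    ∃ x ∈ A, ¬ NonplanarOn H (A \ {x}) := by
  have hapex : IsApex (H.induce A) := by
    refine hG.2 _ _ ⟨fun w => f w, fun w => connectedOn_iff.1 (hconn w w.2), ?_, ?_⟩ ⟨fun φ => ?_⟩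
    · intro w w' hne
      refine Set.disjoint_left.2 fun z hz hz' => hne (Subtype.ext ?_)
      exact hdisj w w.2 w' w'.2 z hz hz'
    · intro w w' h
      exact hadj w w.2 w' w'.2 (by simpa using h)
    · have h1 := Nat.card_congr φ.toEquiv
      have h2 : A.ncard < (Set.univ : Set V).ncard :=
        Set.ncard_lt_ncard ⟨Set.subset_univ _, fun h => hr (h (Set.mem_univ r))⟩ (Set.toFinite _)
      rw [Set.ncard_univ, ← Nat.card_coe_set_eq] at h2
      omega
  have : Nonempty A := hA.to_subtype
  obtain ⟨x, hx⟩ := hapex.exists_not_nonplanarOn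
  refine ⟨x, x.2, fun h => hx ?_⟩
  classical
  refine h.map (fun y => if hy : y ∈ A then ⟨y, hy⟩ else x) ?_ ?_ ?_
  · intro y hy z hz hyz
    simpa [hy.1, hz.1] using hyz
  · intro y hy z hz hyz
    simpa [hy.1, hz.1] using hyz
  · rintro _ ⟨y, hy, rfl⟩
    have := hy.2
    simp only [Set.mem_singleton_iff] at this
    simpa [hy.1, Subtype.ext_iff] using this

theorem IsApexObstruction.exists_not_nonplanarOn_of_lt [Finite V] (hG : IsApexObstruction G)
    {H : SimpleGraph V} (hH : H < G) : ∃ x, ¬ NonplanarOn H {x}ᶜ := by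
  have hapex : IsApex H := by
    refine hG.2 _ _ ⟨fun w => {w}, fun w => connectedOn_iff.1 (connectedOn_singleton G w), ?_, ?_⟩
      ⟨fun φ => ?_⟩
    · intro w w' hne
      simpa using hne
    · intro w w' h
      exact ⟨w, rfl, w', rfl, hH.le h⟩
    · have h1 := Nat.card_congr φ.mapEdgeSet
      have h2 := Set.ncard_lt_ncard (edgeSet_ssubset_edgeSet.2 hH) (Set.toFinite _)
      rw [← Nat.card_coe_set_eq, ← Nat.card_coe_set_eq] at h2
      omega
  have : Nonempty V := by
    by_contra hV
    rw [not_nonempty_iff] at hV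
    exact hH.ne (Subsingleton.elim _ _)
  exact hapex.exists_not_nonplanarOn

theorem IsApexObstruction.exists_not_nonplanarOn_deleteEdges [Finite V]
    (hG : IsApexObstruction G) {u v : V} (huv : G.Adj u v) :
    ∃ x, ¬ NonplanarOn (G.deleteEdges {s(u, v)}) {x}ᶜ := by
  refine hG.exists_not_nonplanarOn_of_lt (lt_of_le_of_ne (deleteEdges_le _) fun h => ?_)
  rw [← h, deleteEdges_adj] at huv
  exact huv.2 rfl

theorem contractEdge_adj {u v x y : V} :
    (contractEdge G u v).Adj x y ↔ x ≠ v ∧ y ≠ v ∧ x ≠ y ∧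
      (G.Adj x y ∨ (x = u ∧ G.Adj v y) ∨ (y = u ∧ G.Adj x v)) := by
  rw [contractEdge, fromRel_adj, G.adj_comm y x, G.adj_comm v x, G.adj_comm y v]
  tauto

theorem IsApexObstruction.exists_not_nonplanarOn_contractEdge [Finite V]
    (hG : IsApexObstruction G) {u v : V} (huv : G.Adj u v) :
    ∃ x ≠ v, ¬ NonplanarOn (contractEdge G u v) {v, x}ᶜ := by
  classical
  obtain ⟨x, hx, h⟩ := hG.exists_not_nonplanarOn_of_minor (H := contractEdge G u v)
    (A := {v}ᶜ) (r := v) (by simp) ⟨u, huv.ne⟩ (fun w => if w = u then {u} ∪ {v} else {w})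
    (by
      intro w _
      split_ifs with hw
      · exact (connectedOn_singleton G u).union_of_adj (connectedOn_singleton G v)
          ⟨u, rfl, v, rfl, Or.inr huv⟩
      · exact connectedOn_singleton G w)
    (by
      simp only [Set.mem_compl_iff, Set.mem_singleton_iff]
      intro w hw w' hw' z hz hz'
      split_ifs at hz hz' <;> simp at hz hz' <;> grind)
    (by
      simp only [Set.mem_compl_iff, Set.mem_singleton_iff]
      intro w hw w' hw' h
      rw [contractEdge_adj] at h
      have hself : ∀ w, w ∈ (if w = u then ({u} ∪ {v} : Set V) else {w}) := by
        intro w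
        split_ifs with h <;> simp [h]
      obtain ⟨-, -, -, h | ⟨rfl, h⟩ | ⟨rfl, h⟩⟩ := h
      · exact ⟨w, hself w, w', hself w', h⟩
      · exact ⟨v, by simp, w', hself w', h⟩
      · exact ⟨w, hself w, v, by simp, h⟩)
  refine ⟨x, hx, fun h' => h (h'.mono le_rfl ?_)⟩
  intro y
  simp

theorem IsApexObstruction.not_disjoint_nonplanarOn [Finite V] (hG : IsApexObstruction G)
    (hconn : ConnectedOn G Set.univ) {A₁ A₂ : Set V} (h₁ : NonplanarOn G A₁)
    (h₂ : NonplanarOn G A₂) (hd : ∀ x ∈ A₁, x ∉ A₂) : False := by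
  let H : SimpleGraph V :=
    { Adj := fun x y => G.Adj x y ∧ ((x ∈ A₁ ∧ y ∈ A₁) ∨ (x ∈ A₂ ∧ y ∈ A₂))
      symm := ⟨fun x y h => ⟨h.1.symm, by tauto⟩⟩
      loopless := ⟨fun x h => h.1.ne rfl⟩ }
  have hne : ∀ {A}, NonplanarOn G A → ∃ x, x ∈ A := fun h => by
    have := h.five_le_ncard
    exact Set.nonempty_of_ncard_ne_zero (by omega)
  obtain ⟨x₁, hx₁⟩ := hne h₁
  obtain ⟨x₂, hx₂⟩ := hne h₂
  obtain ⟨s, -, hs, t, -, ht, hst⟩ := hconn.exists_adj_boundary (P := A₁)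
    ⟨x₁, trivial, hx₁⟩ ⟨x₂, trivial, fun h => hd _ h hx₂⟩
  have hlt : H < G := by
    refine lt_of_le_of_ne (fun x y h => h.1) fun h => ?_
    rw [← h] at hst
    rcases hst.2 with h | h
    · exact ht h.2
    · exact hd s hs h.1
  obtain ⟨x, hx⟩ := hG.exists_not_nonplanarOn_of_lt hlt
  by_cases hxA : x ∈ A₁
  · exact hx (h₂.mono' (fun y hy z hz hyz => ⟨hyz, Or.inr ⟨hy, hz⟩⟩)
      fun y hy hyx => hd x hxA (hyx ▸ hy))
  · exact hx (h₁.mono' (fun y hy z hz hyz => ⟨hyz, Or.inl ⟨hy, hz⟩⟩)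
      fun y hy hyx => hxA (hyx ▸ hy))

end Obstruction

theorem connectedOn_compl_of_vConn {V : Type} [Fintype V] {G : SimpleGraph V}
    (hk : vConn G ≠ 0) (s : Finset V) (hs : s.card < vConn G) : ConnectedOn G (↑s : Set V)ᶜ := by
  rw [vConn] at hk hs
  have hne : {k : ℕ | ∀ s : Finset V, s.card < k → (G.induce ((↑s : Set V)ᶜ)).Connected}.Nonempty :=
    ⟨0, fun s hs => absurd hs (Nat.not_lt_zero _)⟩
  have hbdd : BddAbove
      {k : ℕ | ∀ s : Finset V, s.card < k → (G.induce ((↑s : Set V)ᶜ)).Connected} := by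
    by_contra h
    exact hk (Nat.sSup_of_not_bddAbove h)
  exact connectedOn_iff.2 (Nat.sSup_mem hne hbdd s hs)

/-! ### Basic 2-cuts -/

/-- The properties of a basic 2-cut `{a, b}` with heavy component `C` used in the proof. -/
structure IsBasicSplit {V : Type} (G : SimpleGraph V) (a b : V) (C : Set V) : Prop where
  conn : ConnectedOn G Set.univ
  conn_compl : ∀ x, ConnectedOn G {x}ᶜ
  ne : a ≠ b
  left_notMem : a ∉ C
  right_notMem : b ∉ C
  mem_of_adj : ∀ x ∈ C, ∀ y, G.Adj x y → y ∈ C ∨ y = a ∨ y = b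
  exists_notMem : ∃ y, y ∉ C ∧ y ≠ a ∧ y ≠ b
  nonplanarOn_left : NonplanarOn G (insert a C)
  nonplanarOn_right : NonplanarOn G (insert b C)
  ncard_le : ∀ c d D, IsTwoCut G {c, d} → IsHeavyComp G c d D → C.ncard ≤ D.ncard

/-- `{x}` separates `a` from `b` inside `C ∪ {a, b}`, with `P` containing the side of `a`. -/
structure IsSeparatedAt {V : Type} (G : SimpleGraph V) (a b : V) (C : Set V) (x : V)
    (P : Set V) : Prop where
  left_mem : a ∈ P
  right_notMem : b ∉ P
  notMem : x ∉ P
  mem_of_adj : ∀ p ∈ P, p ∈ insert a (insert b C) → ∀ y ∈ insert a (insert b C), y ≠ x →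
    G.Adj p y → y ∈ P

section BasicSplit

variable {V : Type} {G : SimpleGraph V} {a b : V} {C : Set V}

theorem IsBasicSplit.symm (hS : IsBasicSplit G a b C) : IsBasicSplit G b a C where
  conn := hS.conn
  conn_compl := hS.conn_compl
  ne := hS.ne.symm
  left_notMem := hS.right_notMem
  right_notMem := hS.left_notMem
  mem_of_adj x hx y hxy := (hS.mem_of_adj x hx y hxy).imp_right Or.symm
  exists_notMem := hS.exists_notMem.imp fun _ hy => ⟨hy.1, hy.2.2, hy.2.1⟩
  nonplanarOn_left := hS.nonplanarOn_right
  nonplanarOn_right := hS.nonplanarOn_left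
  ncard_le := hS.ncard_le

theorem IsBasic2Cut.isBasicSplit [Fintype V] (hk : vConn G = 2) (h : IsBasic2Cut G a b C) :
    IsBasicSplit G a b C := by
  obtain ⟨⟨hab, hcut⟩, ⟨⟨-, hd, hconn, hcl⟩, ⟨Ha, hHa, hHaC⟩, Hb, hHb, hHbC⟩, hmin⟩ := h
  have hne : a ≠ b := by
    rintro rfl
    simp at hab
  have hd' : ∀ x ∈ C, x ≠ a ∧ x ≠ b := fun x hx => by
    simpa using Set.disjoint_left.1 hd hx
  refine ⟨?_, fun x => ?_, hne, fun h => (hd' a h).1 rfl, fun h => (hd' b h).2 rfl, ?_, ?_, ?_, ?_,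
    hmin⟩
  · simpa using connectedOn_compl_of_vConn (G := G) (by omega) ∅ (by simp [hk])
  · simpa using connectedOn_compl_of_vConn (G := G) (by omega) {x} (by simp [hk])
  · intro x hx y hxy
    by_contra! hy
    exact hy.1 (hcl x hx y (by simp [hy.2]) hxy)
  · by_contra! hno
    have hC : ({a, b} : Set V)ᶜ = C := by
      ext y
      have := hno y
      have := hd' y
      simp only [Set.mem_compl_iff, Set.mem_insert_iff, Set.mem_singleton_iff]
      tauto
    rw [hC] at hcut
    exact hcut hconn.preconnected
  · refine (hHb.1.nonplanarOn fun _ _ h => h.adj_sub).mono le_rfl fun x hx => ?_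
    have := hHbC hx
    have : x ≠ b := fun h => hHb.2 (h ▸ hx)
    simp_all
  · refine (hHa.1.nonplanarOn fun _ _ h => h.adj_sub).mono le_rfl fun x hx => ?_
    have := hHaC hx
    have : x ≠ a := fun h => hHa.2 (h ▸ hx)
    simp_all

theorem IsSeparatedAt.symm {x : V} {P : Set V} (h : IsSeparatedAt G a b C x P) (hxb : x ≠ b) :
    IsSeparatedAt G b a C x {y | y ∉ P ∧ y ≠ x} where
  left_mem := ⟨h.right_notMem, hxb.symm⟩
  right_notMem h' := h'.1 h.left_mem
  notMem h' := h'.2 rfl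
  mem_of_adj p hp hpR y hyR hyx hpy :=
    ⟨fun hy => hp.1 (h.mem_of_adj y hy (Set.insert_comm a b C ▸ hyR) p
      (Set.insert_comm a b C ▸ hpR) hp.2 hpy.symm), hyx⟩

variable [Finite V]

/-- By minimality of a basic 2-cut, the smaller side of another 2-cut is not heavy. -/
theorem IsBasicSplit.not_nonplanarOn_of_ncard_lt (hG : IsApexObstruction G)
    (hS : IsBasicSplit G a b C) {c d : V} (hcd : c ≠ d) {X : Set V} (hc : c ∉ X) (hd : d ∉ X)
    (hcl : ∀ x ∈ X, ∀ y, G.Adj x y → y ∈ X ∨ y = c ∨ y = d) (hlt : X.ncard < C.ncard)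
    (hout : ∃ y, y ∉ X ∧ y ≠ c ∧ y ≠ d) : ¬ NonplanarOn G (insert c X) := by
  induction hn : X.ncard using Nat.strong_induction_on generalizing X with
  | _ n ih =>
  subst hn
  intro hX
  obtain ⟨x, hx⟩ : X.Nonempty := by
    have h1 := hX.five_le_ncard
    have h2 := Set.ncard_insert_le c X
    exact Set.nonempty_of_ncard_ne_zero (by omega)
  obtain ⟨y, hyX, hyc, hyd⟩ := hout
  obtain ⟨T, hTX, hxT, hT, hTcl⟩ := exists_component G hx
  rcases hTX.eq_or_ssubset with rfl | hTX'
  · have hX' : NonplanarOn G (insert d T) := by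
      refine ((hG.nonplanarOn_compl c).of_cutvertex (c := d) (A₁ := insert d T)
        (A₂ := {z | z ∉ T ∧ z ≠ c}) ?_ ?_ ?_).resolve_right fun h => ?_
      · intro z hz
        by_cases hzT : z ∈ T
        · exact Or.inl (Or.inr hzT)
        · exact Or.inr ⟨hzT, hz⟩
      · rintro s (rfl | hs) t ht hst
        · exact Or.inl ⟨hd, hcd.symm⟩
        · rcases hcl s hs t hst with h | h | h
          · exact Or.inr (Or.inr h)
          · exact absurd h ht.2
          · exact Or.inr (Or.inl h)
      · rintro z ⟨rfl | hz, hz'⟩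
        · rfl
        · exact absurd hz hz'.1
      · refine hG.not_disjoint_nonplanarOn hS.conn hX h ?_
        rintro z (rfl | hz) hz'
        · exact hz'.2 rfl
        · exact hz'.1 hz
    refine absurd (hS.ncard_le c d T ⟨Set.ncard_pair hcd, fun hpre => ?_⟩
      ⟨⟨⟨x, hx⟩, ?_, connectedOn_iff.1 hT, ?_⟩, ?_, ?_⟩) (by omega)
    · have hconn : ConnectedOn G ({c, d} : Set V)ᶜ :=
        connectedOn_iff.2 ((connected_iff _).2 ⟨hpre, ⟨y, by simp [hyc, hyd]⟩⟩)
      have hxcd : x ∈ ({c, d} : Set V)ᶜ := by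
        simpa using ⟨fun h => hc (h ▸ hx), fun h => hd (h ▸ hx)⟩
      obtain ⟨s, -, hs, t, ht, htT, hst⟩ := hconn.exists_adj_boundary (P := T)
        ⟨x, hxcd, hx⟩ ⟨y, by simp [hyc, hyd], hyX⟩
      rcases hcl s hs t hst with h | h
      · exact htT h
      · exact ht h
    · refine Set.disjoint_left.2 ?_
      rintro z hz (rfl | rfl)
      · exact hc hz
      · exact hd hz
    · intro s hs t ht hst
      exact (hcl s hs t hst).resolve_right ht
    · obtain ⟨H, hH, hHT⟩ := hX'.hasKuratowskiOn.exists_subgraph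
      refine ⟨H, ⟨hH, fun h => ?_⟩, fun z hz => ?_⟩
      · rcases hHT h with h | h
        · exact hcd h
        · exact hc h
      · rcases hHT hz with h | h
        · exact Or.inr (Or.inr h)
        · exact Or.inl h
    · obtain ⟨H, hH, hHT⟩ := hX.hasKuratowskiOn.exists_subgraph
      refine ⟨H, ⟨hH, fun h => ?_⟩, fun z hz => ?_⟩
      · rcases hHT h with h | h
        · exact hcd h.symm
        · exact hd h
      · rcases hHT hz with h | h
        · exact Or.inr (Or.inl h)
        · exact Or.inl h
  · have hltT := Set.ncard_lt_ncard hTX' (Set.toFinite _)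
    have hltD : (X \ T).ncard < X.ncard :=
      Set.ncard_lt_ncard ⟨Set.sdiff_subset, fun h => (h hx).2 hxT⟩ (Set.toFinite _)
    have hsplit : ∀ s ∈ T, ∀ t, G.Adj s t → t ∈ T ∨ t = c ∨ t = d := by
      intro s hs t hst
      rcases hcl s (hTX hs) t hst with h | h
      · exact Or.inl (hTcl s hs t h hst)
      · exact Or.inr h
    have hor : NonplanarOn G (insert c T) ∨ NonplanarOn G (insert c (X \ T)) := by
      refine hX.of_cutvertex (c := c) ?_ ?_ ?_
      · rintro z (rfl | hz)
        · exact Or.inl (Or.inl rfl)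
        · by_cases hzT : z ∈ T
          · exact Or.inl (Or.inr hzT)
          · exact Or.inr (Or.inr ⟨hz, hzT⟩)
      · rintro s (rfl | hs) t (rfl | ht) hst
        · exact Or.inl (Or.inl rfl)
        · exact Or.inl (Or.inl rfl)
        · exact Or.inr (Or.inl rfl)
        · exact absurd (hTcl s hs t ht.1 hst) ht.2
      · rintro z ⟨hzc | hz, hzc | hz'⟩
        · exact hzc
        · exact hzc
        · exact hzc
        · exact absurd hz hz'.2
    rcases hor with h | h
    · exact ih _ hltT (fun h => hc (hTX h)) (fun h => hd (hTX h)) hsplit (by omega)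
        ⟨y, fun h => hyX (hTX h), hyc, hyd⟩ rfl h
    · refine ih _ hltD (fun h => hc h.1) (fun h => hd h.1) ?_ (by omega)
        ⟨y, fun h => hyX h.1, hyc, hyd⟩ rfl h
      intro s hs t hst
      rcases hcl s hs.1 t hst with h | h
      · exact Or.inl ⟨h, fun ht => hs.2 (hTcl t ht s hs.1 hst.symm)⟩
      · exact Or.inr h

theorem IsSeparatedAt.not_nonplanarOn_left {x : V} {P : Set V} (h : IsSeparatedAt G a b C x P)
    (hG : IsApexObstruction G) (hS : IsBasicSplit G a b C) (hx : x ∈ C) :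
    ¬ NonplanarOn G (insert x (P ∩ C)) ∧ ¬ NonplanarOn G (insert a (P ∩ C)) := by
  have hxa : x ≠ a := fun h => hS.left_notMem (h ▸ hx)
  have hx' : x ∉ P ∩ C := fun hx => h.notMem hx.1
  have ha' : a ∉ P ∩ C := fun ha => hS.left_notMem ha.2
  have hlt : (P ∩ C).ncard < C.ncard :=
    Set.ncard_lt_ncard ⟨Set.inter_subset_right, fun h => hx' (h hx)⟩ (Set.toFinite _)
  have hcl : ∀ s ∈ P ∩ C, ∀ t, G.Adj s t → t ∈ P ∩ C ∨ t = x ∨ t = a := by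
    intro s hs t hst
    by_cases htx : t = x
    · exact Or.inr (Or.inl htx)
    have hR : ∀ {z}, z ∈ C → z ∈ insert a (insert b C) := fun hz => Or.inr (Or.inr hz)
    rcases hS.mem_of_adj s hs.2 t hst with ht | ht | rfl
    · exact Or.inl ⟨h.mem_of_adj s hs.1 (hR hs.2) t (hR ht) htx hst, ht⟩
    · exact Or.inr (Or.inr ht)
    · exact absurd (h.mem_of_adj s hs.1 (hR hs.2) t (Or.inr (Or.inl rfl)) htx hst) h.right_notMem
  obtain ⟨y, hy, hya, -⟩ := hS.exists_notMem
  have hy' : y ∉ P ∩ C := fun h => hy h.2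
  have hyx : y ≠ x := fun h => hy (h ▸ hx)
  exact ⟨hS.not_nonplanarOn_of_ncard_lt hG hxa hx' ha' hcl hlt ⟨y, hy', hyx, hya⟩,
    hS.not_nonplanarOn_of_ncard_lt hG hxa.symm ha' hx'
      (fun s hs t hst => (hcl s hs t hst).imp_right Or.symm) hlt ⟨y, hy', hya, hyx⟩⟩

theorem IsSeparatedAt.not_nonplanarOn {x : V} {P : Set V} (h : IsSeparatedAt G a b C x P)
    (hG : IsApexObstruction G) (hS : IsBasicSplit G a b C) (hx : x ∈ C) :
    ¬ NonplanarOn G C := by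
  have hxb : x ≠ b := fun h => hS.right_notMem (h ▸ hx)
  intro hC
  have hR : ∀ {z}, z ∈ C → z ∈ insert a (insert b C) := fun hz => Or.inr (Or.inr hz)
  refine ((h.symm hxb).not_nonplanarOn_left hG hS.symm hx).1
    ((hC.of_cutvertex (c := x) (A₁ := insert x (P ∩ C)) ?_ ?_ ?_).resolve_left
      (h.not_nonplanarOn_left hG hS hx).1)
  · intro z hz
    simp only [Set.mem_union, Set.mem_insert_iff, Set.mem_inter_iff, Set.mem_ofPred_eq]
    tauto
  · rintro s (rfl | hs) t (rfl | ht) hst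
    · exact Or.inl (Or.inl rfl)
    · exact Or.inl (Or.inl rfl)
    · exact Or.inr (Or.inl rfl)
    · exact absurd (h.mem_of_adj s hs.1 (hR hs.2) t (hR ht.2) ht.1.2 hst) ht.1.1
  · rintro z ⟨hzx | hz, hzx | hz'⟩
    · exact hzx
    · exact hzx
    · exact hzx
    · exact absurd hz.1 hz'.1.1

theorem IsSeparatedAt.nonplanarOn_compl {x : V} {P : Set V} (h : IsSeparatedAt G a b C x P)
    (hG : IsApexObstruction G) (hS : IsBasicSplit G a b C) (hx : x ∈ C) :
    NonplanarOn G Cᶜ := by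
  have hxa : x ≠ a := fun h => hS.left_notMem (h ▸ hx)
  have hxb : x ≠ b := fun h => hS.right_notMem (h ▸ hx)
  have hR : ∀ {z}, z ∈ C → z ∈ insert a (insert b C) := fun hz => Or.inr (Or.inr hz)
  have h1 : NonplanarOn G ({x} ∪ (P ∩ C))ᶜ := by
    refine ((hG.nonplanarOn_compl x).of_cutvertex (c := a) (A₁ := insert a (P ∩ C)) ?_ ?_
      ?_).resolve_left (h.not_nonplanarOn_left hG hS hx).2
    · intro z hz
      simp only [Set.mem_union, Set.mem_insert_iff, Set.mem_compl_iff,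
        Set.mem_singleton_iff] at hz ⊢
      tauto
    · rintro s (rfl | hs) t ht hst
      · refine Or.inl ?_
        rintro (h | h)
        · exact hxa h.symm
        · exact hS.left_notMem h.2
      · right
        have htx : t ≠ x := fun h => ht (Or.inl h)
        rcases hS.mem_of_adj s hs.2 t hst with h' | h' | rfl
        · exact Or.inr ⟨h.mem_of_adj s hs.1 (hR hs.2) t (hR h') htx hst, h'⟩
        · exact Or.inl h'
        · exact absurd (h.mem_of_adj s hs.1 (hR hs.2) t (Or.inr (Or.inl rfl)) htx hst)
            h.right_notMem
    · rintro z ⟨hz | hz, hz'⟩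
      · exact hz
      · exact absurd (Or.inr hz) hz'
  refine (h1.of_cutvertex (c := b) (A₁ := insert b ({y | y ∉ P ∧ y ≠ x} ∩ C)) ?_ ?_
      ?_).resolve_left ((h.symm hxb).not_nonplanarOn_left hG hS.symm hx).2
  · intro z hz
    simp only [Set.mem_union, Set.mem_insert_iff, Set.mem_compl_iff, Set.mem_singleton_iff,
      Set.mem_inter_iff, Set.mem_ofPred_eq] at hz ⊢
    tauto
  · rintro s (rfl | hs) t ht hst
    · exact Or.inl hS.right_notMem
    · right
      rcases hS.mem_of_adj s hs.2 t hst with h' | rfl | h'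
      · exact absurd h' ht
      · exact absurd (h.mem_of_adj t h.left_mem (Or.inl rfl) s (hR hs.2) hs.1.2 hst.symm) hs.1.1
      · exact Or.inl h'
  · rintro z ⟨hz | hz, hz'⟩
    · exact hz
    · exact absurd hz.2 hz'

/-- The light side of a basic 2-cut becomes nonplanar once its two attachments are joined. -/
theorem IsBasicSplit.nonplanarOn_sup_edge (hG : IsApexObstruction G)
    (hS : IsBasicSplit G a b C) : NonplanarOn (G ⊔ edge a b) Cᶜ := by
  classical
  obtain ⟨o, hoC, hoa, hob⟩ := hS.exists_notMem
  set R : Set V := insert a (insert b C) with hRdef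
  have hmemR : ∀ {z}, z ∈ R ↔ z = a ∨ z = b ∨ z ∈ C := Iff.rfl
  have hoR : o ∈ Rᶜ := by simp [hRdef, hoC, hoa, hob]
  obtain ⟨T, hTR, hoT, hT, hTcl⟩ := exists_component G hoR
  have hbdry : ∀ s ∈ T, ∀ t ∉ T, G.Adj s t → t = a ∨ t = b := by
    intro s hs t ht hst
    have hsR := hTR hs
    have htR : t ∈ R := by
      by_contra h
      exact ht (hTcl s hs t h hst)
    rcases htR with h | h | h
    · exact Or.inl h
    · exact Or.inr h
    · exact absurd (by have := hS.mem_of_adj t h s hst.symm; rw [hmemR]; tauto) hsR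
  have hTa : ∃ s ∈ T, G.Adj s a := by
    obtain ⟨s, -, hs, t, ht, htT, hst⟩ := (hS.conn_compl b).exists_adj_boundary (P := T)
      ⟨o, hob, hoT⟩ ⟨a, hS.ne, fun h => hTR h (Or.inl rfl)⟩
    exact ⟨s, hs, (hbdry s hs t htT hst).resolve_right ht ▸ hst⟩
  have hTb : ∃ s ∈ T, G.Adj s b := by
    obtain ⟨s, -, hs, t, ht, htT, hst⟩ := (hS.conn_compl a).exists_adj_boundary (P := T)
      ⟨o, hoa, hoT⟩ ⟨b, hS.ne.symm, fun h => hTR h (Or.inr (Or.inl rfl))⟩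
    exact ⟨s, hs, (hbdry s hs t htT hst).resolve_left ht ▸ hst⟩
  obtain ⟨w, hwR, hw⟩ := hG.exists_not_nonplanarOn_of_minor (H := G ⊔ edge a b) (A := R) hoR
    ⟨a, Or.inl rfl⟩ (fun w => if w = a then {a} ∪ T else {w})
    (by
      intro w _
      split_ifs
      · obtain ⟨s, hs, hsa⟩ := hTa
        exact (connectedOn_singleton G a).union_of_adj hT ⟨a, rfl, s, hs, Or.inr hsa.symm⟩
      · exact connectedOn_singleton G w)
    (by
      intro w hw w' hw' z hz hz'
      have h1 : z ∈ T → z ∉ R := fun h => hTR h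
      split_ifs at hz hz' <;> simp at hz hz' <;> grind)
    (by
      have hself : ∀ w, w ∈ (if w = a then ({a} ∪ T : Set V) else {w}) := by
        intro w
        split_ifs with h <;> simp [h]
      obtain ⟨s, hs, hsb⟩ := hTb
      rintro w hw w' hw' (h | h)
      · exact ⟨w, hself w, w', hself w', h⟩
      · rw [edge_adj] at h
        obtain ⟨⟨rfl, rfl⟩ | ⟨rfl, rfl⟩, -⟩ := h
        · exact ⟨s, by simp [hs], w', hself w', hsb⟩
        · exact ⟨w, hself w, s, by simp [hs], hsb.symm⟩)
  have hwC : w ∈ C := by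
    rcases hwR with rfl | rfl | h
    · refine absurd (hS.nonplanarOn_right.mono le_sup_left ?_) hw
      exact fun z hz => ⟨Or.inr hz, fun h => by
        rcases hz with hz | hz
        · exact hS.ne (h.symm.trans hz)
        · exact hS.left_notMem (Set.mem_singleton_iff.1 h ▸ hz)⟩
    · refine absurd (hS.nonplanarOn_left.mono le_sup_left ?_) hw
      refine fun z hz => ⟨hz.imp_right Or.inr, fun h => ?_⟩
      rcases hz with hz | hz
      · exact hS.ne (hz.symm.trans h)
      · exact hS.right_notMem (Set.mem_singleton_iff.1 h ▸ hz)
    · exact h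
  refine (((hG.nonplanarOn_compl w).mono (le_sup_left : G ≤ G ⊔ edge a b) subset_rfl).of_separation
    (c := a) (d := b) (A₁ := R \ {w}) (A₂ := Cᶜ) ?_ ?_ ?_ fun h => Or.inr ?_).resolve_left hw
  · intro z hz
    by_cases hzC : z ∈ C
    · exact Or.inl ⟨Or.inr (Or.inr hzC), hz⟩
    · exact Or.inr hzC
  · intro s hs t ht hst
    by_cases hsC : s ∈ C
    · right
      refine ⟨?_, fun h => ht (Set.mem_singleton_iff.1 h ▸ hwC)⟩
      rcases hst with hst | hst
      · rw [hmemR]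
        have := hS.mem_of_adj s hsC t hst
        tauto
      · rw [edge_adj] at hst
        rw [hmemR]
        tauto
    · exact Or.inl hsC
  · rintro z ⟨⟨hz, -⟩, hz'⟩
    rcases hz with hz | hz | hz
    · exact Or.inl hz
    · exact Or.inr hz
    · exact absurd hz hz'
  · rw [edge_adj]
    tauto

/-- If `H` contains the light side and is planar, then the heavy side does not connect `a` and
`b` in `H`. -/
theorem IsBasicSplit.exists_separation (hG : IsApexObstruction G) (hS : IsBasicSplit G a b C)
    {H : SimpleGraph V} {A : Set V} (hH : ∀ x ∉ C, ∀ y ∉ C, G.Adj x y → H.Adj x y)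
    (hCA : Cᶜ ⊆ A) (hA : ¬ NonplanarOn H A) :
    ∃ T ⊆ insert a (insert b C) ∩ A, a ∈ T ∧ b ∉ T ∧
      ∀ x ∈ T, ∀ y ∈ insert a (insert b C) ∩ A, H.Adj x y → y ∈ T := by
  obtain ⟨T, hTA, haT, hT, hTcl⟩ := exists_component H (A := insert a (insert b C) ∩ A) (a := a)
    ⟨Or.inl rfl, hCA hS.left_notMem⟩
  refine ⟨T, hTA, haT, fun hbT => hA ?_, hTcl⟩
  obtain ⟨Q, hQT, haQ, hQ, hQb⟩ := hT.exists_adj_of_mem haT hbT hS.ne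
  refine (hS.nonplanarOn_sup_edge hG).of_edge ?_ hCA (fun x hx => (hTA (hQT hx).1).2) hQ haQ ?_ hQb
  · rintro x hx y hy (hxy | hxy)
    · exact Or.inl (hH x hx y hy hxy)
    · rw [edge_adj] at hxy
      right
      simpa using hxy.1
  · intro x hx hxC
    rcases (hTA (hQT hx).1).1 with h | h | h
    · exact h
    · exact absurd h (hQT hx).2
    · exact absurd h hxC

end BasicSplit

section EdgeCover

variable {V : Type} [Finite V] {G : SimpleGraph V} {a b : V} {C : Set V}

/-- Contracting `uv` keeps a set nonplanar if it does not contain both `u` and `v`; hence such a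
set meets every vertex whose deletion makes the contraction planar. -/
theorem NonplanarOn.exists_of_contractEdge {V : Type} {G : SimpleGraph V} {u v x : V} {D : Set V}
    [DecidableEq V] (h : NonplanarOn (G.deleteEdges {s(u, v)}) D) (huv : u ≠ v)
    (hx : ¬ NonplanarOn (contractEdge G u v) {v, x}ᶜ) (hD : u ∉ D ∨ v ∉ D) :
    ∃ y ∈ D, (if y = v then u else y) = x := by
  by_contra! hno
  refine hx (h.map (fun y => if y = v then u else y) ?_ ?_ ?_)
  · intro y hy z hz hyz
    dsimp only at hyz
    split_ifs at hyz <;> grind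
  · intro y hy z hz hyz
    have hyz' := (deleteEdges_le _ hyz : G.Adj y z)
    rw [contractEdge_adj]
    have := hyz'.ne
    have := hyz'.symm
    split_ifs <;> grind
  · rintro _ ⟨y, hy, rfl⟩
    have := hno y hy
    simp only [Set.mem_compl_iff, Set.mem_insert_iff, Set.mem_singleton_iff, not_or]
    refine ⟨?_, this⟩
    split_ifs with hyv
    · exact huv
    · exact hyv

/-- The situation of an edge `uv` missed by both witnesses: deleting `w` from `G - uv` gives a
planar graph in which `A` is the side of `a`, and `uv` is the only edge leaving `A`. -/
theorem IsBasicSplit.false_of_crossing_edge (hG : IsApexObstruction G)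
    (hS : IsBasicSplit G a b C) {u v w : V} {A : Set V} (huv : G.Adj u v) (hu : u ∈ C)
    (hv : v ∈ C) (hw : w ∈ C) (ha : NonplanarOn (G.deleteEdges {s(u, v)}) (insert a C))
    (hb : NonplanarOn (G.deleteEdges {s(u, v)}) (insert b C))
    (hpl : ¬ NonplanarOn (G.deleteEdges {s(u, v)}) {w}ᶜ)
    (hsep : ∀ P, ¬ IsSeparatedAt G a b C w P) (hAR : A ⊆ insert a (insert b C)) (haA : a ∈ A)
    (hbA : b ∉ A) (hwA : w ∉ A) (huA : u ∈ A) (hvA : v ∉ A) (hvw : v ≠ w)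
    (hcl : ∀ p ∈ A, ∀ y ∈ insert a (insert b C), y ≠ w → G.Adj p y →
      y ∈ A ∨ (p = u ∧ y = v)) : False := by
  classical
  obtain ⟨x, hxv, hx⟩ := hG.exists_not_nonplanarOn_contractEdge huv
  set G' := G.deleteEdges {s(u, v)} with hG'
  have hG'adj : ∀ {p q}, G'.Adj p q → G.Adj p q := fun h => deleteEdges_le _ h
  have hG'uv : ∀ {p q}, G'.Adj p q → ¬ (p = u ∧ q = v) := by
    rintro p q h ⟨rfl, rfl⟩
    rw [hG', deleteEdges_adj] at h
    exact h.2 rfl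
  set R : Set V := insert a (insert b C) with hRdef
  have hmemR : ∀ {z}, z ∈ R ↔ z = a ∨ z = b ∨ z ∈ C := Iff.rfl
  have haC := hS.left_notMem
  have hbC := hS.right_notMem
  have hab := hS.ne
  have hne : ∀ {z}, z ∈ C → z ≠ a ∧ z ≠ b :=
    fun hz => ⟨fun h => haC (h ▸ hz), fun h => hbC (h ▸ hz)⟩
  have hsplit : ∀ D ⊆ R, NonplanarOn G' D → NonplanarOn G' (insert w (A ∩ D)) ∨
      NonplanarOn G' (insert w (D \ A)) := by
    intro D hDR hD
    refine hD.of_cutvertex (c := w) ?_ ?_ ?_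
    · intro z hz
      by_cases hzA : z ∈ A
      · exact Or.inl (Or.inr ⟨hzA, hz⟩)
      · exact Or.inr (Or.inr ⟨hz, hzA⟩)
    · rintro p (rfl | hp) q (rfl | hq) hpq
      · exact Or.inl (Or.inl rfl)
      · exact Or.inl (Or.inl rfl)
      · exact Or.inr (Or.inl rfl)
      · by_cases hqw : q = w
        · exact Or.inr (Or.inl hqw)
        · rcases hcl p hp.1 q (hDR hq.1) hqw (hG'adj hpq) with h | h
          · exact absurd h hq.2
          · exact absurd h (hG'uv hpq)
    · rintro z ⟨hzw | hz, hzw | hz'⟩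
      · exact hzw
      · exact hzw
      · exact hzw
      · exact absurd hz.1 hz'.2
  have hcases : (x ∈ C ∧ NonplanarOn G C) ∨ ((x = u ∨ x = w) ∧
      NonplanarOn G' (insert w A) ∧ NonplanarOn G' (insert w (R \ A))) := by
    have hC : ∀ D ⊆ C, NonplanarOn G' D → (u ∉ D ∨ v ∉ D) → x ∈ C ∧ NonplanarOn G C := by
      intro D hD h huvD
      obtain ⟨y, hy, hyx⟩ := h.exists_of_contractEdge huv.ne hx huvD
      refine ⟨?_, h.mono (deleteEdges_le _) hD⟩
      rw [← hyx]
      split_ifs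
      · exact hu
      · exact hD hy
    have huw : u ≠ w := fun h => hwA (h ▸ huA)
    rcases hsplit _ (fun z hz => Or.inr hz) hb with h1 | h1
    · left
      refine hC _ ?_ h1 (Or.inr ?_)
      · rintro z (rfl | ⟨hzA, rfl | hz⟩)
        · exact hw
        · exact absurd hzA hbA
        · exact hz
      · rintro (h | h)
        · exact hvw h
        · exact hvA h.1
    rcases hsplit _ (Set.insert_subset_insert (Set.subset_insert _ _)) ha with h2 | h2
    · right
      have h1' : NonplanarOn G' (insert w (R \ A)) := h1.mono le_rfl
        (Set.insert_subset_insert (Set.sdiff_subset_sdiff_left (Set.subset_insert _ _)))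
      have h2' : NonplanarOn G' (insert w A) := h2.mono le_rfl
        (Set.insert_subset_insert Set.inter_subset_left)
      refine ⟨?_, h2', h1'⟩
      obtain ⟨y, hy, hyx⟩ := h1'.exists_of_contractEdge huv.ne hx (Or.inl (by
        rintro (h | h)
        · exact huw h
        · exact h.2 huA))
      obtain ⟨z, hz, hzx⟩ := h2'.exists_of_contractEdge huv.ne hx (Or.inr (by
        rintro (h | h)
        · exact hvw h
        · exact hvA h))
      rcases hy with hy | hy <;> rcases hz with hz | hz <;> grind
    · left
      refine hC _ ?_ h2 (Or.inl ?_)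
      · rintro z (rfl | ⟨rfl | hz, hzA⟩)
        · exact hw
        · exact absurd haA hzA
        · exact hz
      · rintro (h | h)
        · exact huw h
        · exact h.2 huA
  have hxC : x ∈ C := by
    rcases hcases with h | ⟨rfl | rfl, -⟩
    exacts [h.1, hu, hw]
  obtain ⟨T, hTR, haT, hbT, hTcl⟩ := hS.exists_separation hG (H := contractEdge G u v)
    (A := {v, x}ᶜ) (by
      intro p hp q hq hpq
      rw [contractEdge_adj]
      exact ⟨fun h => hp (h ▸ hv), fun h => hq (h ▸ hv), hpq.ne, Or.inl hpq⟩)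
    (by
      rintro z hz (h | h)
      · exact hz (h ▸ hv)
      · exact hz (Set.mem_singleton_iff.1 h ▸ hxC)) hx
  have hvT : v ∉ T := fun h => (hTR h).2 (Or.inl rfl)
  have hxT : x ∉ T := fun h => (hTR h).2 (Or.inr rfl)
  have huR : u ∈ R := Or.inr (Or.inr hu)
  have hvR : v ∈ R := Or.inr (Or.inr hv)
  by_cases hxu : x = u
  · subst hxu
    have hTG : ∀ p ∈ T, ∀ y ∈ R, y ≠ v → y ≠ x → G.Adj p y → y ∈ T := by
      intro p hp y hy hyv hyx hpy
      refine hTcl p hp y ⟨hy, by simp [hyv, hyx]⟩ ?_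
      rw [contractEdge_adj]
      exact ⟨fun h => hvT (h ▸ hp), hyv, hpy.ne, Or.inl hpy⟩
    by_cases hwT : w ∈ T
    · have hZ : IsSeparatedAt G b a C v {z | z ∈ R ∧ z ∉ A ∧ z ≠ v ∧ z ∉ T} := by
        refine ⟨⟨Or.inr (Or.inl rfl), hbA, (hne hv).2.symm, hbT⟩, fun h => h.2.1 haA,
          fun h => h.2.2.1 rfl, ?_⟩
        rintro p ⟨hpR, hpA, hpv, hpT⟩ - y hy hyv hpy
        rw [Set.insert_comm] at hy
        have hpw : p ≠ w := fun h => hpT (h ▸ hwT)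
        have hpx : p ≠ x := fun h => hpA (h ▸ huA)
        refine ⟨hy, fun hyA => ?_, hyv, fun hyT => ?_⟩
        · rcases hcl y hyA p hpR hpw hpy.symm with h | h
          · exact hpA h
          · exact hpv h.2
        · exact hpT (hTG y hyT p hpR hpv hpx hpy.symm)
      have hGC := hZ.not_nonplanarOn hG hS.symm hv
      rcases hcases with h | ⟨-, -, h⟩
      · exact hGC h.2
      rcases h.of_cutvertex (c := v) (A₁ := insert v {z | z ∈ R ∧ z ∉ A ∧ z ≠ v ∧ z ∉ T})
        (A₂ := insert w (R \ A) \ {z | z ∈ R ∧ z ∉ A ∧ z ≠ v ∧ z ∉ T})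
        (by
          intro z hz
          by_cases h : z ∈ {z | z ∈ R ∧ z ∉ A ∧ z ≠ v ∧ z ∉ T}
          · exact Or.inl (Or.inr h)
          · exact Or.inr ⟨hz, h⟩)
        (by
          rintro p (rfl | hp) q hq hpq
          · exact Or.inl ⟨Or.inr ⟨hvR, hvA⟩, hZ.notMem⟩
          · refine Or.inr ?_
            by_cases hqv : q = v
            · exact Or.inl hqv
            · have hqR : q ∈ R := by
                rcases hq.1 with rfl | h
                · exact Or.inr (Or.inr hw)
                · exact h.1
              refine Or.inr (hZ.mem_of_adj p hp ?_ q ?_ hqv (hG'adj hpq))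
              · rw [Set.insert_comm]
                exact hp.1
              · rw [Set.insert_comm]
                exact hqR)
        (by
          rintro z ⟨hzv | hz, hz'⟩
          · exact hzv
          · exact absurd hz hz'.2) with h1 | h1
      · refine hpl (h1.mono le_rfl ?_)
        rintro z (rfl | hz) hzw
        · exact hvw hzw
        · exact hz.2.2.2 (Set.mem_singleton_iff.1 hzw ▸ hwT)
      · refine hGC (h1.mono (deleteEdges_le _) ?_)
        rintro z ⟨rfl | ⟨hzR, hzA⟩, hz⟩
        · exact hw
        · rcases hzR with rfl | rfl | h
          · exact absurd haA hzA
          · exact absurd hZ.left_mem hz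
          · exact h
    · have hP : IsSeparatedAt G a b C x (T ∩ A) := by
        refine ⟨⟨haT, haA⟩, fun h => hbA h.2, fun h => hxT h.1, ?_⟩
        rintro p ⟨hpT, hpA⟩ - y hy hyx hpy
        have hpx : p ≠ x := fun h => hxT (h ▸ hpT)
        have hyv : y ≠ v := by
          rintro rfl
          rcases hcl p hpA y hy hvw hpy with h | h
          · exact hvA h
          · exact hpx h.1
        have hyT := hTG p hpT y hy hyv hyx hpy
        refine ⟨hyT, ?_⟩
        rcases hcl p hpA y hy (fun h => hwT (h ▸ hyT)) hpy with h | h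
        · exact h
        · exact absurd h.1 hpx
      have hGC := hP.not_nonplanarOn hG hS hu
      rcases hcases with h | ⟨-, h, -⟩
      · exact hGC h.2
      rcases h.of_cutvertex (c := x) (A₁ := insert x (T ∩ A)) (A₂ := insert w A \ (T ∩ A))
        (by
          intro z hz
          by_cases h : z ∈ T ∩ A
          · exact Or.inl (Or.inr h)
          · exact Or.inr ⟨hz, h⟩)
        (by
          rintro p (rfl | hp) q hq hpq
          · exact Or.inl ⟨Or.inr huA, hP.notMem⟩
          · refine Or.inr ?_
            by_cases hqx : q = x
            · exact Or.inl hqx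
            · have hqR : q ∈ R := by
                rcases hq.1 with rfl | h
                · exact Or.inr (Or.inr hw)
                · exact hAR h
              exact Or.inr (hP.mem_of_adj p hp (hAR hp.2) q hqR hqx (hG'adj hpq)))
        (by
          rintro z ⟨hzv | hz, hz'⟩
          · exact hzv
          · exact absurd hz hz'.2) with h1 | h1
      · refine hpl (h1.mono le_rfl ?_)
        rintro z (rfl | hz) hzw
        · exact hwA (Set.mem_singleton_iff.1 hzw ▸ huA)
        · exact hwA (Set.mem_singleton_iff.1 hzw ▸ hz.2)
      · refine hGC (h1.mono (deleteEdges_le _) ?_)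
        rintro z ⟨rfl | hzA, hz⟩
        · exact hw
        · rcases hAR hzA with rfl | rfl | h
          · exact absurd hP.left_mem hz
          · exact absurd hzA hbA
          · exact h
  · have hP : IsSeparatedAt G a b C x {y | (if y = v then u else y) ∈ T} := by
      refine ⟨?_, ?_, ?_, ?_⟩
      · simpa [(hne hv).1.symm] using haT
      · simpa [(hne hv).2.symm] using hbT
      · simpa [hxv] using hxT
      · intro p hp _ y hy hyx hpy
        simp only [Set.mem_ofPred_eq] at hp ⊢
        by_cases hπ : (if p = v then u else p) = (if y = v then u else y)
        · rwa [← hπ]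
        · refine hTcl _ hp _ ⟨?_, ?_⟩ ?_
          · split_ifs
            exacts [huR, hy]
          · have := huv.ne
            simp only [Set.mem_compl_iff, Set.mem_insert_iff, Set.mem_singleton_iff]
            split_ifs <;> grind
          · have := huv.ne
            have := hpy.symm
            rw [contractEdge_adj]
            split_ifs <;> grind
    rcases hcases with h | ⟨rfl | rfl, -⟩
    · exact hP.not_nonplanarOn hG hS hxC h.2
    · exact hxu rfl
    · exact hsep _ hP

theorem IsBasicSplit.false_of_nonplanarOn_deleteEdges (hG : IsApexObstruction G)
    (hS : IsBasicSplit G a b C) {u v : V} (huv : G.Adj u v) (hu : u ∈ C) (hv : v ∈ C)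
    (ha : NonplanarOn (G.deleteEdges {s(u, v)}) (insert a C))
    (hb : NonplanarOn (G.deleteEdges {s(u, v)}) (insert b C)) : False := by
  obtain ⟨w, hw⟩ := hG.exists_not_nonplanarOn_deleteEdges huv
  have hwC : w ∈ C := by
    by_contra hwC
    have hD : ∀ {c}, NonplanarOn (G.deleteEdges {s(u, v)}) (insert c C) → w = c := by
      intro c hc
      by_contra hwc
      refine hw (hc.mono le_rfl ?_)
      rintro z (rfl | hz) hzw
      · exact hwc (Set.mem_singleton_iff.1 hzw).symm
      · exact hwC (Set.mem_singleton_iff.1 hzw ▸ hz)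
    exact hS.ne ((hD ha).symm.trans (hD hb))
  have hlight : ∀ x ∉ C, ∀ y ∉ C, G.Adj x y → (G.deleteEdges {s(u, v)}).Adj x y := by
    intro x hx y hy hxy
    rw [deleteEdges_adj]
    refine ⟨hxy, fun h => ?_⟩
    rcases Sym2.eq_iff.1 (Set.mem_singleton_iff.1 h) with h | h
    · exact hx (h.1 ▸ hu)
    · exact hx (h.1 ▸ hv)
  have hCw : Cᶜ ⊆ {w}ᶜ := fun z hz h => hz (Set.mem_singleton_iff.1 h ▸ hwC)
  have hsep : ∀ P, ¬ IsSeparatedAt G a b C w P := fun P hP =>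
    hw ((hP.nonplanarOn_compl hG hS hwC).mono' hlight hCw)
  obtain ⟨A, hAR, haA, hbA, hAcl⟩ := hS.exists_separation hG hlight hCw hw
  have hwA : w ∉ A := fun h => (hAR h).2 rfl
  have hAcl' : ∀ p ∈ A, ∀ y ∈ insert a (insert b C), y ≠ w → G.Adj p y →
      y ∈ A ∨ s(p, y) = s(u, v) := by
    intro p hp y hy hyw hpy
    by_cases h : s(p, y) = s(u, v)
    · exact Or.inr h
    · exact Or.inl (hAcl p hp y ⟨hy, hyw⟩ (by rw [deleteEdges_adj]; exact ⟨hpy, h⟩))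
  obtain ⟨p, hp, y, hy, hyw, hpy, hyA⟩ : ∃ p ∈ A, ∃ y ∈ insert a (insert b C), y ≠ w ∧
      G.Adj p y ∧ y ∉ A := by
    by_contra! hno
    exact hsep A ⟨haA, hbA, hwA, fun p hp _ y hy hyw hpy => hno p hp y hy hyw hpy⟩
  have hpyuv := (hAcl' p hp y hy hyw hpy).resolve_left hyA
  have hpyC : p ∈ C ∧ y ∈ C := by
    rcases Sym2.eq_iff.1 hpyuv with ⟨rfl, rfl⟩ | ⟨rfl, rfl⟩
    exacts [⟨hu, hv⟩, ⟨hv, hu⟩]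
  rw [← hpyuv] at ha hb hw hAcl'
  refine hS.false_of_crossing_edge hG hpy hpyC.1 hpyC.2 hwC ha hb hw hsep
    (fun z hz => (hAR hz).1) haA hbA hwA hp hyA hyw fun q hq z hz hzw hqz => ?_
  refine (hAcl' q hq z hz hzw hqz).imp_right fun h => ?_
  rcases Sym2.eq_iff.1 h with h | h
  · exact h
  · exact absurd (h.1 ▸ hq) hyA

/-- A Kuratowski subgraph avoiding `a` and the edge `uv` forces `insert b C` to stay nonplanar
after deleting `uv`. -/
theorem IsBasicSplit.nonplanarOn_of_witness (hG : IsApexObstruction G)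
    (hS : IsBasicSplit G a b C) {H : G.Subgraph} (hH : IsKuratowskiWitness G a H) {u v : V}
    (huv : ¬ H.Adj u v) : NonplanarOn (G.deleteEdges {s(u, v)}) (insert b C) := by
  have h : NonplanarOn (G.deleteEdges {s(u, v)}) {a}ᶜ := by
    refine (hH.1.nonplanarOn fun x y hxy => ?_).mono le_rfl
      fun x hx hxa => hH.2 (Set.mem_singleton_iff.1 hxa ▸ hx)
    rw [deleteEdges_adj]
    refine ⟨hxy.adj_sub, fun h => huv ?_⟩
    rcases Sym2.eq_iff.1 (Set.mem_singleton_iff.1 h) with ⟨rfl, rfl⟩ | ⟨rfl, rfl⟩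
    exacts [hxy, hxy.symm]
  refine (h.of_cutvertex (c := b) (A₁ := insert b C) (A₂ := {z | z ∉ C ∧ z ≠ a}) ?_ ?_
    ?_).resolve_right fun h' => hG.not_disjoint_nonplanarOn hS.conn hS.nonplanarOn_left
      (h'.mono (deleteEdges_le _) subset_rfl) ?_
  · intro z hz
    by_cases hzC : z ∈ C
    · exact Or.inl (Or.inr hzC)
    · exact Or.inr ⟨hzC, hz⟩
  · rintro s (rfl | hs) t ht hst
    · exact Or.inl ⟨hS.right_notMem, hS.ne.symm⟩
    · rcases hS.mem_of_adj s hs t (deleteEdges_le _ hst) with h | h | h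
      · exact absurd h ht.1
      · exact absurd h ht.2
      · exact Or.inr (Or.inl h)
  · rintro z ⟨hz | hz, hz'⟩
    · exact hz
    · exact absurd hz hz'.1
  · rintro z (rfl | hz) hz'
    · exact hz'.2 rfl
    · exact hz'.1 hz

end EdgeCover

/-- Every edge of `G` with both endpoints in the heavy component of a basic 2-cut lies in
`E(H_a) ∪ E(H_b)`, for any Kuratowski subgraphs `H_a`, `H_b` avoiding `a` and `b`. -/
theorem heavy_component_edge_cover {V : Type} [Fintype V] (G : SimpleGraph V)
    (hG : IsApexObstruction G) (hk : vConn G = 2) (a b : V) (C : Set V)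
    (hbasic : IsBasic2Cut G a b C)
    (Ha Hb : G.Subgraph)
    (hHa : IsKuratowskiWitness G a Ha) (hHb : IsKuratowskiWitness G b Hb) :
    ∀ u v : V, G.Adj u v → u ∈ C → v ∈ C → Ha.Adj u v ∨ Hb.Adj u v := by
  have hS := hbasic.isBasicSplit hk
  intro u v huv hu hv
  by_contra! hno
  exact hS.false_of_nonplanarOn_deleteEdges hG huv hu hv
    (hS.symm.nonplanarOn_of_witness hG hHb hno.2) (hS.nonplanarOn_of_witness hG hHa hno.1)
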